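/- Let p be a prime, K a field of characteristic p and n ∈ ℕ. Then for all a, b, c ∈ W_n(K) one has ((a, bc))_{p^n} + ((b, ac))_{p^n} + ((c, ab))_{p^n} = 0 in Br(K), where bc, ac, ab are products in the ring W_n(K) of truncated p-typical Witt vectors. -/

import Mathlib

noncomputable section

/-- The product `∏ i, x i ^ e i` over the support of `e`, with factors multiplied in
increasing order of the index. -/
def ordProd {σ M : Type*} [LinearOrder σ] [Monoid M] (x : σ → M) (e : σ →₀ ℕ) : M :=
  ((e.support.sort (· ≤ ·)).map fun i => x i ^ e i).prod

/-- Evaluation of a multivariate polynomial in a (possibly noncommutative) algebra: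
each monomial is evaluated as the ordered product of the powers of the substituted
values, the variables being multiplied in increasing order of their (linearly ordered)
index. -/
def pEval {σ R A : Type*} [LinearOrder σ] [CommSemiring R] [Semiring A] [Algebra R A]
    (x : σ → A) (q : MvPolynomial σ R) : A :=
  q.support.sum fun e => MvPolynomial.coeff e q • ordProd x e

/-- Evaluation of an integral polynomial in the commuting variables `X_d` (`d : ℕ+`, left
summand) and `Y_e` (`e : ℕ+`, right summand), substituting `x d` for `X_d` and `y e` for
`Y_e`; in each monomial all `X`-factors (in increasing index order) are multiplied to the
left of all `Y`-factors (in increasing index order), as appropriate for a polynomial in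
`ℤ[X][Y]`. -/
def cEval {A : Type*} [Ring A] (x y : ℕ+ → A) (q : MvPolynomial (ℕ+ ⊕ₗ ℕ+) ℤ) : A :=
  pEval (fun v => Sum.elim x y (ofLex v)) q

/-- The `k`-th ghost value `w_k(g) = ∑_{d ∣ k} d · (g d)^(k/d)`. -/
def ghost {A : Type*} [Ring A] (g : ℕ+ → A) (k : ℕ+) : A :=
  ∑ d ∈ (k : ℕ).divisors.attach,
    ((d : ℕ) : A) * g ⟨(d : ℕ), Nat.pos_of_mem_divisors d.2⟩ ^ ((k : ℕ) / (d : ℕ))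

/-- The generator `x_d` of the free algebra underlying `B(ℚ)`. -/
def bXf (d : ℕ+) : FreeAlgebra ℚ (ℕ+ ⊕ ℕ+) := FreeAlgebra.ι ℚ (Sum.inl d)

/-- The generator `y_e` of the free algebra underlying `B(ℚ)`. -/
def bYf (e : ℕ+) : FreeAlgebra ℚ (ℕ+ ⊕ ℕ+) := FreeAlgebra.ι ℚ (Sum.inr e)

/-- The defining relations of `B(ℚ)`: `[w_k(x), w_l(x)] = 0`, `[w_k(y), w_l(y)] = 0` and
`[w_l(y), w_k(x)] = δ_{k,l}·k` for all `k, l ≥ 1`. -/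
inductive BRel : FreeAlgebra ℚ (ℕ+ ⊕ ℕ+) → FreeAlgebra ℚ (ℕ+ ⊕ ℕ+) → Prop
  | xx (k l : ℕ+) : BRel (ghost bXf k * ghost bXf l) (ghost bXf l * ghost bXf k)
  | yy (k l : ℕ+) : BRel (ghost bYf k * ghost bYf l) (ghost bYf l * ghost bYf k)
  | yx (k l : ℕ+) : BRel (ghost bYf l * ghost bXf k)
      (ghost bXf k * ghost bYf l + if k = l then ((k : ℕ) : FreeAlgebra ℚ (ℕ+ ⊕ ℕ+)) else 0)

/-- The universal algebra `B(ℚ)`. -/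
abbrev BQ : Type := RingQuot BRel

/-- The generator `x_d` of `B(ℚ)`. -/
def bx (d : ℕ+) : BQ := RingQuot.mkAlgHom ℚ BRel (bXf d)

/-- The generator `y_e` of `B(ℚ)`. -/
def by' (e : ℕ+) : BQ := RingQuot.mkAlgHom ℚ BRel (bYf e)

/-- `c` is a family of polynomials `c_{m,n}` as in the paper: `c m n` is an integral
polynomial in the variables `X_d` (`d` a proper divisor of `m`) and `Y_e` (`e` a proper
divisor of `n`) such that `[y_n, x_m] = c_{m,n}(x, y)` holds in `B(ℚ)`. -/
def IsCFamily (c : ℕ+ → ℕ+ → MvPolynomial (ℕ+ ⊕ₗ ℕ+) ℤ) : Prop :=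
  ∀ m n : ℕ+,
    (∀ v ∈ (c m n).vars,
      (∃ d : ℕ+, (d : ℕ) ∣ (m : ℕ) ∧ d ≠ m ∧ ofLex v = Sum.inl d) ∨
      (∃ e : ℕ+, (e : ℕ) ∣ (n : ℕ) ∧ e ≠ n ∧ ofLex v = Sum.inr e)) ∧
    cEval bx by' (c m n) = by' n * bx m - bx m * by' n


/-- `p ^ i` as a positive natural number. -/
def ppow (p i : ℕ) : ℕ+ := (p ^ i).toPNat'

/-- Substitution of the generators `x_0, …, x_{m-1}` for the variables `X_{p^0}, …, X_{p^{m-1}}`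
(the variable `X_{p^r}` is sent to `x_r`). -/
def sxm (R : Type*) [CommRing R] (p m n : ℕ) : ℕ+ → FreeAlgebra R (Fin m ⊕ Fin n) :=
  fun d => if h : padicValNat p (d : ℕ) < m
    then FreeAlgebra.ι R (Sum.inl ⟨padicValNat p (d : ℕ), h⟩) else 0

/-- Substitution of the generators `y_0, …, y_{n-1}` for the variables `Y_{p^0}, …, Y_{p^{n-1}}`
(the variable `Y_{p^s}` is sent to `y_s`). -/
def syn (R : Type*) [CommRing R] (p m n : ℕ) : ℕ+ → FreeAlgebra R (Fin m ⊕ Fin n) :=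
  fun e => if h : padicValNat p (e : ℕ) < n
    then FreeAlgebra.ι R (Sum.inr ⟨padicValNat p (e : ℕ), h⟩) else 0

/-- The defining relations of the truncated `p`-typical algebra `B_{m,n}(R)`:
`[x_i, x_{i'}] = 0`, `[y_j, y_{j'}] = 0` and
`[y_j, x_i] = c_{p^i, p^j}(x_0, …, x_{i-1}, y_0, …, y_{j-1})`. -/
inductive BmnRel (R : Type*) [CommRing R] (p : ℕ)
    (c : ℕ+ → ℕ+ → MvPolynomial (ℕ+ ⊕ₗ ℕ+) ℤ) (m n : ℕ) :
    FreeAlgebra R (Fin m ⊕ Fin n) → FreeAlgebra R (Fin m ⊕ Fin n) → Prop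
  | xx (i i' : Fin m) : BmnRel R p c m n
      (FreeAlgebra.ι R (Sum.inl i) * FreeAlgebra.ι R (Sum.inl i'))
      (FreeAlgebra.ι R (Sum.inl i') * FreeAlgebra.ι R (Sum.inl i))
  | yy (j j' : Fin n) : BmnRel R p c m n
      (FreeAlgebra.ι R (Sum.inr j) * FreeAlgebra.ι R (Sum.inr j'))
      (FreeAlgebra.ι R (Sum.inr j') * FreeAlgebra.ι R (Sum.inr j))
  | yx (i : Fin m) (j : Fin n) : BmnRel R p c m n
      (FreeAlgebra.ι R (Sum.inr j) * FreeAlgebra.ι R (Sum.inl i))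
      (FreeAlgebra.ι R (Sum.inl i) * FreeAlgebra.ι R (Sum.inr j) +
        cEval (sxm R p m n) (syn R p m n) (c (ppow p (i : ℕ)) (ppow p (j : ℕ))))

/-- The truncated `p`-typical algebra `B_{m,n}(R)`. -/
abbrev Bmn (R : Type*) [CommRing R] (p : ℕ) (c : ℕ+ → ℕ+ → MvPolynomial (ℕ+ ⊕ₗ ℕ+) ℤ)
    (m n : ℕ) : Type _ := RingQuot (BmnRel R p c m n)

/-- The generator `x_i` of `B_{m,n}(R)`. -/
def gx (R : Type*) [CommRing R] (p : ℕ) (c : ℕ+ → ℕ+ → MvPolynomial (ℕ+ ⊕ₗ ℕ+) ℤ)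
    (m n : ℕ) (i : Fin m) : Bmn R p c m n :=
  RingQuot.mkAlgHom R (BmnRel R p c m n) (FreeAlgebra.ι R (Sum.inl i))

/-- The generator `y_j` of `B_{m,n}(R)`. -/
def gy (R : Type*) [CommRing R] (p : ℕ) (c : ℕ+ → ℕ+ → MvPolynomial (ℕ+ ⊕ₗ ℕ+) ℤ)
    (m n : ℕ) (j : Fin n) : Bmn R p c m n :=
  RingQuot.mkAlgHom R (BmnRel R p c m n) (FreeAlgebra.ι R (Sum.inr j))
/-- The relations `x_i^{p^n} = a_i`, `y_j^{p^m} = b_j` defining `A_{((a,b))_{p^m,p^n}}`. -/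
inductive ASRel (K : Type*) [Field K] (p : ℕ) [Fact p.Prime]
    (c : ℕ+ → ℕ+ → MvPolynomial (ℕ+ ⊕ₗ ℕ+) ℤ) (m n : ℕ)
    (a : TruncatedWittVector p m K) (b : TruncatedWittVector p n K) :
    Bmn K p c m n → Bmn K p c m n → Prop
  | xa (i : Fin m) : ASRel K p c m n a b
      (gx K p c m n i ^ p ^ n) (algebraMap K (Bmn K p c m n) (a.coeff i))
  | yb (j : Fin n) : ASRel K p c m n a b
      (gy K p c m n j ^ p ^ m) (algebraMap K (Bmn K p c m n) (b.coeff j))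

/-- The central simple algebra `A_{((a,b))_{p^m,p^n}}`. -/
abbrev Asymb (K : Type*) [Field K] (p : ℕ) [Fact p.Prime]
    (c : ℕ+ → ℕ+ → MvPolynomial (ℕ+ ⊕ₗ ℕ+) ℤ) (m n : ℕ)
    (a : TruncatedWittVector p m K) (b : TruncatedWittVector p n K) : Type _ :=
  RingQuot (ASRel K p c m n a b)

/-- The image of the generator `x_i` in `A_{((a,b))_{p^m,p^n}}`. -/
def aX (K : Type*) [Field K] (p : ℕ) [Fact p.Prime]
    (c : ℕ+ → ℕ+ → MvPolynomial (ℕ+ ⊕ₗ ℕ+) ℤ) (m n : ℕ)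
    (a : TruncatedWittVector p m K) (b : TruncatedWittVector p n K) (i : Fin m) :
    Asymb K p c m n a b :=
  RingQuot.mkAlgHom K (ASRel K p c m n a b) (gx K p c m n i)

/-- The image of the generator `y_j` in `A_{((a,b))_{p^m,p^n}}`. -/
def aY (K : Type*) [Field K] (p : ℕ) [Fact p.Prime]
    (c : ℕ+ → ℕ+ → MvPolynomial (ℕ+ ⊕ₗ ℕ+) ℤ) (m n : ℕ)
    (a : TruncatedWittVector p m K) (b : TruncatedWittVector p n K) (j : Fin n) :
    Asymb K p c m n a b :=
  RingQuot.mkAlgHom K (ASRel K p c m n a b) (gy K p c m n j)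

/-- Two `K`-algebras are Brauer equivalent if they become isomorphic after tensoring with
matrix algebras, i.e. `M_r(A) ≅ M_s(B)` for some `r, s ≥ 1`. -/
def BrauerEquiv (K : Type*) [Field K] (A B : Type*) [Ring A] [Algebra K A]
    [Ring B] [Algebra K B] : Prop :=
  ∃ r s : ℕ, 0 < r ∧ 0 < s ∧
    Nonempty (Matrix (Fin r) (Fin r) A ≃ₐ[K] Matrix (Fin s) (Fin s) B)

section Evaluation

variable {σ R A B : Type*} [LinearOrder σ] [CommRing R] [Ring A] [Ring B] [Algebra R A] [Algebra R B]

lemma map_ordProd {M N F : Type*} [Monoid M] [Monoid N] [FunLike F M N] [MonoidHomClass F M N]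
    (f : F) (x : σ → M) (e : σ →₀ ℕ) : f (ordProd x e) = ordProd (fun i => f (x i)) e := by
  simp [ordProd, map_list_prod, Function.comp_def]

lemma map_cEval (f : A →+* B) (x y : ℕ+ → A) (q : MvPolynomial (ℕ+ ⊕ₗ ℕ+) ℤ) :
    f (cEval x y q) = cEval (fun d => f (x d)) (fun e => f (y e)) q := by
  simp only [cEval, pEval, map_sum, map_zsmul, map_ordProd]
  refine Finset.sum_congr rfl fun e _ => ?_
  congr 2
  funext v
  rcases hv : ofLex v with d | d <;> simp

lemma ordProd_congr {M : Type*} [Monoid M] {x y : σ → M} {e : σ →₀ ℕ}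
    (h : ∀ i ∈ e.support, x i = y i) : ordProd x e = ordProd y e := by
  unfold ordProd
  congr 1
  refine List.map_congr_left fun i hi => ?_
  rw [h i ((Finset.mem_sort _).1 hi)]

lemma cEval_congr {x y x' y' : ℕ+ → A} {q : MvPolynomial (ℕ+ ⊕ₗ ℕ+) ℤ}
    (h : ∀ v ∈ q.vars, Sum.elim x y (ofLex v) = Sum.elim x' y' (ofLex v)) :
    cEval x y q = cEval x' y' q := by
  refine Finset.sum_congr rfl fun e he => ?_
  rw [ordProd_congr fun i hi => h i (MvPolynomial.mem_vars_iff_mem_support i |>.2 ⟨e, he, hi⟩)]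

lemma cEval_mem (S : Subring A) {x y : ℕ+ → A} {q : MvPolynomial (ℕ+ ⊕ₗ ℕ+) ℤ}
    (h : ∀ v ∈ q.vars, Sum.elim x y (ofLex v) ∈ S) : cEval x y q ∈ S := by
  refine S.sum_mem fun e he => S.zsmul_mem ?_ _
  refine S.list_prod_mem fun z hz => ?_
  obtain ⟨i, hi, rfl⟩ := List.mem_map.1 hz
  exact S.pow_mem (h i (MvPolynomial.mem_vars_iff_mem_support i |>.2 ⟨e, he, (Finset.mem_sort _).1 hi⟩)) _

lemma map_ghost (f : A →+* B) (g : ℕ+ → A) (k : ℕ+) :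
    f (ghost g k) = ghost (fun d => f (g d)) k := by
  simp [ghost]

end Evaluation

section CommutingFamilies

variable {σ τ R A : Type*} [CommRing R] [Ring A] [Algebra R A]

open scoped IsMulCommutative in
/-- Evaluation of polynomials at a family of pairwise commuting elements of a possibly
noncommutative algebra. -/
def ncAeval (y : σ → A) (h : ∀ i j, Commute (y i) (y j)) : MvPolynomial σ R →ₐ[R] A :=
  have : IsMulCommutative (Algebra.adjoin R (Set.range y)) :=
    Algebra.isMulCommutative_adjoin R (by rintro _ ⟨i, rfl⟩ _ ⟨j, rfl⟩; exact h i j)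
  (Algebra.adjoin R (Set.range y)).val.comp
    (MvPolynomial.aeval fun i => ⟨y i, Algebra.subset_adjoin ⟨i, rfl⟩⟩)

@[simp]
lemma ncAeval_X (y : σ → A) (h : ∀ i j, Commute (y i) (y j)) (i : σ) :
    ncAeval (R := R) y h (MvPolynomial.X i) = y i := by
  simp [ncAeval]

lemma ncAeval_rename (y : σ → A) (h : ∀ i j, Commute (y i) (y j)) (f : τ → σ)
    (q : MvPolynomial τ R) :
    ncAeval y h (MvPolynomial.rename f q) = ncAeval (y ∘ f) (fun i j => h (f i) (f j)) q := by
  have : (ncAeval (R := R) y h).comp (MvPolynomial.rename f) =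
      ncAeval (y ∘ f) (fun i j => h (f i) (f j)) := by
    ext i; simp
  exact DFunLike.congr_fun this q

lemma ncAeval_mem (S : Subalgebra R A) {y : σ → A} {h : ∀ i j, Commute (y i) (y j)}
    {q : MvPolynomial σ R} (hy : ∀ i ∈ q.vars, y i ∈ S) : ncAeval y h q ∈ S := by
  have H : MvPolynomial.supported R (q.vars : Set σ) ≤ S.comap (ncAeval y h) :=
    Algebra.adjoin_le (by rintro _ ⟨i, hi, rfl⟩; simpa using hy i hi)
  exact H (MvPolynomial.mem_supported.2 subset_rfl)

lemma commute_ncAeval {y : σ → A} {h : ∀ i j, Commute (y i) (y j)} {q : MvPolynomial σ R} {a : A}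
    (ha : ∀ i ∈ q.vars, Commute a (y i)) : Commute a (ncAeval y h q) := by
  have := ncAeval_mem (Subalgebra.centralizer R {a}) (h := h) (q := q)
    (fun i hi => by rw [Subalgebra.mem_centralizer_iff]; rintro _ rfl; exact ha i hi)
  exact (Subalgebra.mem_centralizer_iff R).1 this a rfl

lemma commute_ncAeval_ncAeval {y : σ → A} {h : ∀ i j, Commute (y i) (y j)} {q : MvPolynomial σ R}
    {x : τ → A} {h' : ∀ i j, Commute (x i) (x j)} {r : MvPolynomial τ R}
    (ha : ∀ i ∈ q.vars, ∀ j ∈ r.vars, Commute (y i) (x j)) :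
    Commute (ncAeval y h q) (ncAeval x h' r) :=
  commute_ncAeval fun j hj => (commute_ncAeval fun i hi => (ha i hi j hj).symm).symm

end CommutingFamilies

section Transfer

open MvPolynomial

/-- The polynomials expressing the big Witt components in terms of the ghost components. -/
def bigX (d : ℕ+) : MvPolynomial ℕ+ ℚ :=
  C ((d : ℚ)⁻¹) * (X d - ∑ e ∈ (d : ℕ).properDivisors.attach,
    have : (⟨(e : ℕ), Nat.pos_of_mem_properDivisors e.2⟩ : ℕ+) < d :=
      (Nat.mem_properDivisors.1 e.2).2
    C (e : ℚ) * bigX ⟨(e : ℕ), Nat.pos_of_mem_properDivisors e.2⟩ ^ ((d : ℕ) / (e : ℕ)))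
termination_by d

lemma ghost_eq {A : Type*} [Ring A] (g : ℕ+ → A) (k : ℕ+) :
    ghost g k = ∑ d ∈ (k : ℕ).divisors, (d : A) * g d.toPNat' ^ ((k : ℕ) / d) := by
  rw [ghost, ← Finset.sum_attach (k : ℕ).divisors]
  refine Finset.sum_congr rfl fun d _ => ?_
  congr 3
  apply PNat.eq
  simp [Nat.toPNat'_coe, Nat.pos_of_mem_divisors d.2]

lemma ghost_bigX (k : ℕ+) : ghost bigX k = X k := by
  rw [ghost_eq, ← Nat.cons_self_properDivisors k.ne_zero, Finset.sum_cons]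
  have hk : (k : ℕ).toPNat' = k := PNat.coe_toPNat' k
  rw [hk, Nat.div_self k.pos, pow_one, bigX, ← mul_assoc]
  have h1 : ((k : ℕ) : MvPolynomial ℕ+ ℚ) * C ((k : ℚ)⁻¹) = 1 := by
    rw [← map_natCast (C : ℚ →+* MvPolynomial ℕ+ ℚ), ← C_mul, mul_inv_cancel₀, C_1]
    exact_mod_cast k.ne_zero
  rw [h1, one_mul, sub_add_eq_add_sub, sub_eq_iff_eq_add, ← Finset.sum_attach (k : ℕ).properDivisors]
  congr 1
  refine Finset.sum_congr rfl fun d _ => ?_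
  rw [map_natCast]
  congr 3
  apply PNat.eq
  simp [Nat.toPNat'_coe, Nat.pos_of_mem_properDivisors d.2]

lemma coe_ppow (p : ℕ) [hp : Fact p.Prime] (i : ℕ) : ((ppow p i : ℕ+) : ℕ) = p ^ i := by
  simp [ppow, Nat.toPNat'_coe, hp.out.pos]

lemma ppow_injective (p : ℕ) [hp : Fact p.Prime] : Function.Injective (ppow p) := fun i j h =>
  Nat.pow_right_injective hp.out.two_le (by simpa [coe_ppow] using congrArg PNat.val h)

lemma bigX_ppow (p : ℕ) [hp : Fact p.Prime] (i : ℕ) :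
    bigX (ppow p i) = rename (ppow p) (xInTermsOfW p ℚ i) := by
  have h (k : ℕ) : aeval (fun r => bigX (ppow p r)) (wittPolynomial p ℚ k) = X (ppow p k) := by
    rw [aeval_wittPolynomial, ← ghost_bigX, ghost_eq, coe_ppow,
      Nat.sum_divisors_prime_pow hp.out]
    refine Finset.sum_congr rfl fun r hr => ?_
    rw [Nat.pow_div (Nat.lt_succ_iff.1 (Finset.mem_range.1 hr)) hp.out.pos]
    push_cast
    rfl
  have h2 := congrArg (aeval fun r => bigX (ppow p r)) (bind₁_wittPolynomial_xInTermsOfW p ℚ i)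
  rw [aeval_X, aeval_bind₁] at h2
  simp only [h] at h2
  rw [← h2, show rename (ppow p) = aeval (fun k => (X (ppow p k) : MvPolynomial ℕ+ ℚ)) from by ext; simp]

variable {E : Type*} [Ring E] [Algebra ℚ E]

lemma cEval_eq_of_ghosts {c : ℕ+ → ℕ+ → MvPolynomial (ℕ+ ⊕ₗ ℕ+) ℤ} (hc : IsCFamily c)
    {ξ η : ℕ+ → E} (hξ : ∀ k l, Commute (ξ k) (ξ l)) (hη : ∀ k l, Commute (η k) (η l))
    (h : ∀ k l, η l * ξ k = ξ k * η l + if k = l then ((k : ℕ) : E) else 0) (m n : ℕ+) :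
    cEval (fun d => ncAeval ξ hξ (bigX d)) (fun e => ncAeval η hη (bigX e)) (c m n) =
      ncAeval η hη (bigX n) * ncAeval ξ hξ (bigX m) -
        ncAeval ξ hξ (bigX m) * ncAeval η hη (bigX n) := by
  set xs : ℕ+ → E := fun d => ncAeval ξ hξ (bigX d) with hxs
  set ys : ℕ+ → E := fun e => ncAeval η hη (bigX e) with hys
  have gx (k) : ghost xs k = ξ k := by
    refine (map_ghost (ncAeval ξ hξ : _ →ₐ[ℚ] E).toRingHom bigX k).symm.trans ?_
    simp [ghost_bigX]
  have gy (k) : ghost ys k = η k := by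
    refine (map_ghost (ncAeval η hη : _ →ₐ[ℚ] E).toRingHom bigX k).symm.trans ?_
    simp [ghost_bigX]
  let F : FreeAlgebra ℚ (ℕ+ ⊕ ℕ+) →ₐ[ℚ] E := FreeAlgebra.lift ℚ (Sum.elim xs ys)
  have Fx (k) : F (ghost bXf k) = ξ k := by
    rw [← gx]; exact (map_ghost F.toRingHom _ _).trans (by simp [F, bXf])
  have Fy (k) : F (ghost bYf k) = η k := by
    rw [← gy]; exact (map_ghost F.toRingHom _ _).trans (by simp [F, bYf])
  let G : BQ →ₐ[ℚ] E := RingQuot.liftAlgHom ℚ ⟨F, by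
    intro a b hab
    cases hab with
    | xx k l => simpa [Fx] using (hξ k l).eq
    | yy k l => simpa [Fy] using (hη k l).eq
    | yx k l =>
      rw [map_mul, map_add, map_mul, Fx, Fy, h]
      split_ifs <;> simp⟩
  have Gx (d) : G (bx d) = xs d := by simp [G, bx, F, bXf]
  have Gy (d) : G (by' d) = ys d := by simp [G, by', F, bYf]
  have := congrArg G (hc m n).2
  rw [map_sub, map_mul, map_mul, Gx, Gy] at this
  rw [← this]
  refine Eq.symm ((map_cEval G.toRingHom _ _ _).trans ?_)
  simp [Gx, Gy]

/-- The variables of `c_{p^i,p^j}` are the `X_{p^r}` with `r < i` and the `Y_{p^s}`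
with `s < j`. -/
lemma IsCFamily.vars_ppow {c : ℕ+ → ℕ+ → MvPolynomial (ℕ+ ⊕ₗ ℕ+) ℤ} (hc : IsCFamily c)
    (p : ℕ) [hp : Fact p.Prime] {i j : ℕ} {v : ℕ+ ⊕ₗ ℕ+} (hv : v ∈ (c (ppow p i) (ppow p j)).vars) :
    (∃ r < i, ofLex v = Sum.inl (ppow p r)) ∨ (∃ s < j, ofLex v = Sum.inr (ppow p s)) := by
  have aux (i : ℕ) (d : ℕ+) (h : (d : ℕ) ∣ (ppow p i : ℕ+)) (h' : d ≠ ppow p i) :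
      ∃ r < i, d = ppow p r := by
    rw [coe_ppow] at h
    obtain ⟨r, hr, hd⟩ := (Nat.dvd_prime_pow hp.out).1 h
    have hd' : d = ppow p r := PNat.eq (by rw [hd, coe_ppow])
    exact ⟨r, lt_of_le_of_ne hr (by rintro rfl; exact h' hd'), hd'⟩
  rcases (hc _ _).1 v hv with ⟨d, h1, h2, h3⟩ | ⟨d, h1, h2, h3⟩
  · obtain ⟨r, hr, rfl⟩ := aux i d h1 h2
    exact Or.inl ⟨r, hr, h3⟩
  · obtain ⟨r, hr, rfl⟩ := aux j d h1 h2
    exact Or.inr ⟨r, hr, h3⟩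

lemma padicValNat_ppow (p : ℕ) [hp : Fact p.Prime] (i : ℕ) :
    padicValNat p (ppow p i : ℕ+) = i := by
  rw [coe_ppow, padicValNat.prime_pow]

/-- A `p`-typical form of `cEval` only depending on the `p`-adic valuation of the indices. -/
lemma IsCFamily.cEval_ppow_congr {c : ℕ+ → ℕ+ → MvPolynomial (ℕ+ ⊕ₗ ℕ+) ℤ} (hc : IsCFamily c)
    (p : ℕ) [hp : Fact p.Prime] {A : Type*} [Ring A] {x y x' y' : ℕ+ → A} {i j : ℕ}
    (hx : ∀ r < i, x (ppow p r) = x' (ppow p r)) (hy : ∀ s < j, y (ppow p s) = y' (ppow p s)) :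
    cEval x y (c (ppow p i) (ppow p j)) = cEval x' y' (c (ppow p i) (ppow p j)) :=
  cEval_congr fun v hv => by
    rcases hc.vars_ppow p hv with ⟨r, hr, h⟩ | ⟨r, hr, h⟩ <;> simp [h, hx, hy, hr]

lemma IsCFamily.cEval_ppow_mem {c : ℕ+ → ℕ+ → MvPolynomial (ℕ+ ⊕ₗ ℕ+) ℤ} (hc : IsCFamily c)
    (p : ℕ) [hp : Fact p.Prime] {A : Type*} [Ring A] (S : Subring A) {x y : ℕ+ → A} {i j : ℕ}
    (hx : ∀ r < i, x (ppow p r) ∈ S) (hy : ∀ s < j, y (ppow p s) ∈ S) :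
    cEval x y (c (ppow p i) (ppow p j)) ∈ S :=
  cEval_mem S fun v hv => by
    rcases hc.vars_ppow p hv with ⟨r, hr, h⟩ | ⟨r, hr, h⟩ <;> simp [h, hx, hy, hr]

end Transfer

section IteratedFrobenius

open MvPolynomial

variable (p : ℕ)

/-- The polynomials describing the components of the `n`-fold Frobenius of a Witt vector. -/
def iterFrobeniusPoly : ℕ → ℕ → MvPolynomial ℕ ℤ
  | 0, i => X i
  | n + 1, i => bind₁ (WittVector.frobeniusPoly p) (iterFrobeniusPoly n i)

/-- Substitution of the Witt components, written in terms of the ghost components, into an integral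
polynomial. -/
def toGhost [Fact p.Prime] : MvPolynomial ℕ ℤ →+* MvPolynomial ℕ ℚ :=
  ((bind₁ (xInTermsOfW p ℚ)).toRingHom).comp (map (Int.castRingHom ℚ))

@[simp]
lemma toGhost_X [Fact p.Prime] (i : ℕ) : toGhost p (X i) = xInTermsOfW p ℚ i := by
  simp [toGhost]

lemma toGhost_iterFrobeniusPoly [Fact p.Prime] (n i : ℕ) :
    toGhost p (iterFrobeniusPoly p n i) = rename (· + n) (xInTermsOfW p ℚ i) := by
  have key (q : MvPolynomial ℕ ℤ) :
      toGhost p (bind₁ (WittVector.frobeniusPoly p) q) = rename (· + 1) (toGhost p q) := by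
    have h : (toGhost p).comp (bind₁ (WittVector.frobeniusPoly p)).toRingHom =
        (rename (R := ℚ) (· + 1)).toRingHom.comp (toGhost p) := by
      refine ringHom_ext (fun r => by simp [toGhost]) fun k => ?_
      have h1 : bind₁ (xInTermsOfW p ℚ) (WittVector.frobeniusPolyRat p k) =
          rename (· + 1) (xInTermsOfW p ℚ k) := by
        rw [WittVector.frobeniusPolyRat, bind₁_bind₁]
        simp only [Function.comp_def, bind₁_xInTermsOfW_wittPolynomial]
        rw [bind₁, rename_eq_aeval]
        rfl
      simp [toGhost, WittVector.map_frobeniusPoly, h1]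
    exact RingHom.congr_fun h q
  induction n with
  | zero => simp [iterFrobeniusPoly]; exact (rename_id_apply _).symm
  | succ n ih =>
    rw [iterFrobeniusPoly, key, ih, rename_rename]
    rfl

lemma dvd_iterFrobeniusPoly_sub (n i : ℕ) :
    (p : MvPolynomial ℕ ℤ) ∣ iterFrobeniusPoly p n i - X i ^ p ^ n := by
  induction n with
  | zero => simp [iterFrobeniusPoly]
  | succ n ih =>
    have h := map_dvd (bind₁ (WittVector.frobeniusPoly p)) ih
    rw [map_natCast, map_sub, map_pow, bind₁_X_right] at h
    rw [iterFrobeniusPoly, ← sub_add_sub_cancel _ (WittVector.frobeniusPoly p i ^ p ^ n)]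
    refine dvd_add h ?_
    rw [pow_succ', pow_mul]
    refine dvd_trans ?_ (sub_dvd_pow_sub_pow _ _ _)
    rw [WittVector.frobeniusPoly, add_sub_cancel_left]
    exact ⟨WittVector.frobeniusPolyAux p i, by simp⟩

lemma dvd_iterFrobeniusPoly_pow_sub (n i k : ℕ) :
    (p ^ (k + 1) : MvPolynomial ℕ ℤ) ∣ iterFrobeniusPoly p n i ^ p ^ k - X i ^ p ^ (n + k) := by
  rw [pow_add p n k, pow_mul]
  exact dvd_sub_pow_of_dvd_sub (dvd_iterFrobeniusPoly_sub p n i) k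

end IteratedFrobenius

section HeisenbergPair

open MvPolynomial

attribute [local instance] LieRing.ofAssociativeRing

variable (p : ℕ) [hp : Fact p.Prime] {E : Type*} [Ring E] [Algebra ℚ E]

/-- The Witt components of a commuting family of ghost components. -/
def wittOfGhost (w : ℕ → E) (hw : ∀ i j, Commute (w i) (w j)) (i : ℕ) : E :=
  ncAeval w hw (xInTermsOfW p ℚ i)

/-- Evaluation of an integral polynomial at the Witt components of a commuting family of ghost
components. -/
def evalOfGhost (w : ℕ → E) (hw : ∀ i j, Commute (w i) (w j)) : MvPolynomial ℕ ℤ →+* E :=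
  (ncAeval (R := ℚ) w hw).toRingHom.comp (toGhost p)

variable {w : ℕ → E} {hw : ∀ i j, Commute (w i) (w j)}
  {v : ℕ → E} {hv : ∀ i j, Commute (v i) (v j)}

@[simp]
lemma evalOfGhost_X (i : ℕ) : evalOfGhost p w hw (X i) = wittOfGhost p w hw i := by
  simp [evalOfGhost, wittOfGhost]

lemma evalOfGhost_mem (S : Subring E) (hS : ∀ i, wittOfGhost p w hw i ∈ S)
    (q : MvPolynomial ℕ ℤ) : evalOfGhost p w hw q ∈ S := by
  induction q using MvPolynomial.induction_on with
  | C a => simp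
  | add q r hq hr => rw [map_add]; exact S.add_mem hq hr
  | mul_X q i hq => rw [map_mul, evalOfGhost_X]; exact S.mul_mem hq (hS i)

lemma evalOfGhost_iterFrobeniusPoly (n i : ℕ) :
    evalOfGhost p w hw (iterFrobeniusPoly p n i) =
      ncAeval (fun k => w (k + n)) (fun _ _ => hw _ _) (xInTermsOfW p ℚ i) := by
  simp only [evalOfGhost, RingHom.comp_apply, toGhost_iterFrobeniusPoly]
  exact ncAeval_rename _ _ _ _

lemma sum_evalOfGhost_iterFrobeniusPoly (n i : ℕ) :
    ∑ r ∈ Finset.range (i + 1), (p : E) ^ r * evalOfGhost p w hw (iterFrobeniusPoly p n r) ^ p ^ (i - r) =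
      w (i + n) := by
  have h := congrArg (ncAeval (fun k => w (k + n)) (fun _ _ => hw _ _))
    (bind₁_xInTermsOfW_wittPolynomial p ℚ i)
  rw [ncAeval_X] at h
  rw [← h, bind₁, aeval_wittPolynomial, map_sum]
  refine Finset.sum_congr rfl fun r _ => ?_
  rw [evalOfGhost_iterFrobeniusPoly]
  simp

/-- The vanishing of commutators with disjoint ghost components. -/
lemma commute_wittOfGhost_iterFrobeniusPoly
    (hvw : ∀ k l, k ≠ l → Commute (v l) (w k)) {j s : ℕ} (hjs : j < s) (r : ℕ) :
    Commute (wittOfGhost p v hv j) (evalOfGhost p w hw (iterFrobeniusPoly p s r)) := by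
  rw [evalOfGhost_iterFrobeniusPoly]
  refine commute_ncAeval_ncAeval fun a ha b _ => hvw _ _ ?_
  have := xInTermsOfW_vars_subset p j ha
  rw [Finset.mem_range] at this
  omega

lemma lie_wittOfGhost_pow (S : Subring E) (hwS : ∀ i, wittOfGhost p w hw i ∈ S)
    (hvS : ∀ i, wittOfGhost p v hv i ∈ S) (hvw : ∀ k l, k ≠ l → Commute (v l) (w k))
    {j s : ℕ} (hjs : j < s) (r : ℕ) :
    ∃ t ∈ S, ⁅wittOfGhost p v hv j, wittOfGhost p w hw r ^ p ^ s⁆ = p * t := by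
  obtain ⟨θ, hθ⟩ := dvd_iterFrobeniusPoly_sub p s r
  rw [sub_eq_iff_eq_add', ← sub_eq_iff_eq_add] at hθ
  have h := congrArg (evalOfGhost p w hw) hθ
  simp only [map_sub, map_mul, map_natCast, map_pow, evalOfGhost_X] at h
  refine ⟨-⁅wittOfGhost p v hv j, evalOfGhost p w hw θ⁆, ?_, ?_⟩
  · have h1 := evalOfGhost_mem p S hwS θ
    rw [Ring.lie_def]
    exact S.neg_mem (S.sub_mem (S.mul_mem (hvS j) h1) (S.mul_mem h1 (hvS j)))
  · rw [← h, lie_sub, (commute_iff_lie_eq.1 (commute_wittOfGhost_iterFrobeniusPoly p hvw hjs r)),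
      zero_sub, mul_neg]
    simp [← nsmul_eq_mul]

lemma lie_pow_wittOfGhost (S : Subring E) (hwS : ∀ i, wittOfGhost p w hw i ∈ S)
    (hvS : ∀ i, wittOfGhost p v hv i ∈ S) (hvw : ∀ k l, k ≠ l → Commute (v l) (w k))
    {r i : ℕ} (hri : r < i) (j : ℕ) :
    ∃ t ∈ S, ⁅wittOfGhost p v hv j ^ p ^ i, wittOfGhost p w hw r⁆ = p * t := by
  obtain ⟨t, ht, h⟩ := lie_wittOfGhost_pow (hv := hw) (hw := hv) p S hvS hwS
    (fun k l hkl => (hvw l k hkl.symm).symm) hri j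
  exact ⟨-t, S.neg_mem ht, by rw [← lie_skew, h, mul_neg]⟩

lemma lie_evalOfGhost (hvw : ∀ k l, v l * w k = w k * v l + if k = l then (p : E) ^ k else 0)
    (hunit : IsUnit (p : E)) (i j : ℕ) :
    ⁅v (i + j), evalOfGhost p w hw (iterFrobeniusPoly p j i)⁆ = (p : E) ^ j := by
  have hc (k l) (h : k ≠ l) : Commute (v l) (w k) := by
    rw [commute_iff_eq, hvw, if_neg h, add_zero]
  have h := sum_evalOfGhost_iterFrobeniusPoly (hw := hw) p j i
  have h2 : ⁅v (i + j), w (i + j)⁆ = (p : E) ^ (i + j) := by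
    rw [Ring.lie_def, hvw]; simp
  rw [← h, Finset.sum_range_succ, lie_add, Nat.sub_self, pow_zero, pow_one,
    commute_iff_lie_eq.1, zero_add] at h2
  · refine (hunit.pow i).mul_left_cancel ?_
    rw [← pow_add, ← h2, ← Nat.cast_pow, ← nsmul_eq_mul, ← nsmul_eq_mul, lie_nsmul]
  · refine Commute.sum_right _ _ _ fun r hr => ?_
    rw [← Nat.cast_pow]
    refine (Nat.cast_commute _ _).symm.mul_right (Commute.pow_right ?_ _)
    rw [evalOfGhost_iterFrobeniusPoly]
    refine commute_ncAeval fun a ha => hc _ _ ?_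
    have := xInTermsOfW_vars_subset p r ha
    rw [Finset.mem_range] at this hr
    omega

lemma lie_pow_wittOfGhost_pow (S : Subring E) (hwS : ∀ i, wittOfGhost p w hw i ∈ S)
    (hvS : ∀ i, wittOfGhost p v hv i ∈ S)
    (hvw : ∀ k l, v l * w k = w k * v l + if k = l then (p : E) ^ k else 0)
    (hunit : IsUnit (p : E)) (i j : ℕ) :
    ∃ t ∈ S, ⁅wittOfGhost p v hv j ^ p ^ i, wittOfGhost p w hw i ^ p ^ j⁆ = 1 + p * t := by
  have hc (k l) (h : k ≠ l) : Commute (v l) (w k) := by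
    rw [commute_iff_eq, hvw, if_neg h, add_zero]
  have hlie {a b : E} (ha : a ∈ S) (hb : b ∈ S) : ⁅a, b⁆ ∈ S :=
    S.sub_mem (S.mul_mem ha hb) (S.mul_mem hb ha)
  set A := evalOfGhost p w hw (iterFrobeniusPoly p j i) with hA
  have hAS : A ∈ S := evalOfGhost_mem p S hwS _
  have hterm (r : ℕ) (hr : r < j) : ∃ t ∈ S,
      ⁅(p : E) ^ r * evalOfGhost p v hv (iterFrobeniusPoly p i r) ^ p ^ (j - r), A⁆ =
        (p : E) ^ j * (p * t) := by
    obtain ⟨θ, hθ⟩ := dvd_iterFrobeniusPoly_pow_sub p i r (j - r)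
    rw [sub_eq_iff_eq_add] at hθ
    have h := congrArg (evalOfGhost p v hv) hθ
    simp only [map_add, map_mul, map_natCast, map_pow, evalOfGhost_X] at h
    refine ⟨⁅evalOfGhost p v hv θ, A⁆, hlie (evalOfGhost_mem p S hvS _) hAS, ?_⟩
    have h0 : ⁅wittOfGhost p v hv r ^ p ^ (i + (j - r)), A⁆ = 0 :=
      commute_iff_lie_eq.1 ((commute_wittOfGhost_iterFrobeniusPoly p hc hr i).pow_left _)
    rw [h, mul_add, add_lie, ← mul_assoc, ← pow_add, ← mul_assoc, ← pow_succ]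
    rw [show r + (j - r + 1) = j + 1 by omega]
    simp only [← Nat.cast_pow, ← nsmul_eq_mul, nsmul_lie, h0, smul_zero, add_zero]
  choose! t htS ht using hterm
  have hmain := lie_evalOfGhost (hw := hw) p hvw hunit i j
  rw [add_comm, ← sum_evalOfGhost_iterFrobeniusPoly (hw := hv) p i j, Finset.sum_range_succ,
    add_lie, Nat.sub_self, pow_zero, pow_one] at hmain
  have hsum : ⁅∑ r ∈ Finset.range j, (p : E) ^ r *
      evalOfGhost p v hv (iterFrobeniusPoly p i r) ^ p ^ (j - r), A⁆ =
      (p : E) ^ j * (p * ∑ r ∈ Finset.range j, t r) := by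
    rw [sum_lie, Finset.mul_sum, Finset.mul_sum]
    exact Finset.sum_congr rfl fun r hr => ht r (Finset.mem_range.1 hr)
  have hpull : ⁅(p : E) ^ j * evalOfGhost p v hv (iterFrobeniusPoly p i j), A⁆ =
      (p : E) ^ j * ⁅evalOfGhost p v hv (iterFrobeniusPoly p i j), A⁆ := by
    simp only [← Nat.cast_pow, ← nsmul_eq_mul, nsmul_lie]
  rw [← hA, hsum, hpull, ← mul_add] at hmain
  have hB : ⁅evalOfGhost p v hv (iterFrobeniusPoly p i j), A⁆ =
      1 - p * ∑ r ∈ Finset.range j, t r := by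
    refine eq_sub_iff_add_eq'.2 ((hunit.pow j).mul_left_cancel ?_)
    rw [hmain, mul_one]
  obtain ⟨θ, hθ⟩ := dvd_iterFrobeniusPoly_sub p i j
  obtain ⟨θ', hθ'⟩ := dvd_iterFrobeniusPoly_sub p j i
  have h := congrArg (evalOfGhost p v hv) hθ
  have h' := congrArg (evalOfGhost p w hw) hθ'
  simp only [map_sub, map_mul, map_natCast, map_pow, evalOfGhost_X] at h h'
  rw [sub_eq_iff_eq_add'] at h
  rw [← hA, sub_eq_iff_eq_add] at h'
  rw [h', h] at hB
  have hyS : wittOfGhost p v hv j ^ p ^ i ∈ S := S.pow_mem (hvS j) _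
  have hxS : wittOfGhost p w hw i ^ p ^ j ∈ S := S.pow_mem (hwS i) _
  have hθS := evalOfGhost_mem (hw := hv) p S hvS θ
  have hθS' := evalOfGhost_mem (hw := hw) p S hwS θ'
  have hpS : (p : E) * evalOfGhost p w hw θ' ∈ S := S.mul_mem (natCast_mem S p) hθS'
  refine ⟨-(∑ r ∈ Finset.range j, t r) - ⁅evalOfGhost p v hv θ, A⁆ -
    ⁅wittOfGhost p v hv j ^ p ^ i, evalOfGhost p w hw θ'⁆,
    S.sub_mem (S.sub_mem (S.neg_mem (S.sum_mem fun r hr => htS r (Finset.mem_range.1 hr)))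
      (hlie hθS hAS)) (hlie hyS hθS'), ?_⟩
  rw [← h', add_lie] at hB
  have e1 : ⁅wittOfGhost p v hv j ^ p ^ i, A⁆ = p * ⁅wittOfGhost p v hv j ^ p ^ i,
      evalOfGhost p w hw θ'⁆ + ⁅wittOfGhost p v hv j ^ p ^ i, wittOfGhost p w hw i ^ p ^ j⁆ := by
    rw [h', lie_add]
    simp only [← nsmul_eq_mul, lie_nsmul]
  have e2 : ⁅(p : E) * evalOfGhost p v hv θ, A⁆ = p * ⁅evalOfGhost p v hv θ, A⁆ := by
    simp only [← nsmul_eq_mul, nsmul_lie]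
  rw [e1, e2] at hB
  rw [mul_sub, mul_sub, mul_neg, ← sub_eq_zero]
  rw [← sub_eq_zero] at hB
  rw [← hB]
  abel

/-- The commutators of Witt components of a big Heisenberg pair. -/
lemma lie_wittOfGhost {c : ℕ+ → ℕ+ → MvPolynomial (ℕ+ ⊕ₗ ℕ+) ℤ} (hc : IsCFamily c)
    {ξ η : ℕ+ → E} (hξ : ∀ k l, Commute (ξ k) (ξ l)) (hη : ∀ k l, Commute (η k) (η l))
    (h : ∀ k l, η l * ξ k = ξ k * η l + if k = l then ((k : ℕ) : E) else 0) (i j : ℕ) :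
    ⁅wittOfGhost p (η ∘ ppow p) (fun _ _ => hη _ _) j, wittOfGhost p (ξ ∘ ppow p) (fun _ _ => hξ _ _) i⁆ =
      cEval (fun d => wittOfGhost p (ξ ∘ ppow p) (fun _ _ => hξ _ _) (padicValNat p d))
        (fun e => wittOfGhost p (η ∘ ppow p) (fun _ _ => hη _ _) (padicValNat p e))
        (c (ppow p i) (ppow p j)) := by
  have h1 := cEval_eq_of_ghosts hc hξ hη h (ppow p i) (ppow p j)
  simp only [bigX_ppow, ncAeval_rename] at h1
  rw [Ring.lie_def]
  refine h1.symm.trans (hc.cEval_ppow_congr p ?_ ?_) <;>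
  · intro r _
    rw [bigX_ppow, ncAeval_rename, padicValNat_ppow]
    rfl

end HeisenbergPair

section Density

variable {K R : Type*} [Field K] [CommRing R] [Algebra K R]

lemma pow_apply_mul_pow {D : Module.End K R} {x : R} (hD1 : D 1 = 0)
    (hDx : ∀ f, D (x * f) = x * D f + f) {q : R} (hq : ∀ f, D (q * f) = q * D f) (k l : ℕ) :
    (D ^ k) (q * x ^ l) = (l.descFactorial k : R) * (q * x ^ (l - k)) := by
  have h1 (l : ℕ) : D (q * x ^ l) = l * (q * x ^ (l - 1)) := by
    rw [hq]
    suffices h : D (x ^ l) = l * x ^ (l - 1) by rw [h]; ring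
    induction l with
    | zero => simp [hD1]
    | succ l ih =>
      rw [pow_succ', hDx, ih]
      rcases l with _ | l
      · simp
      · simp only [Nat.add_sub_cancel]; push_cast; ring
  induction k with
  | zero => simp
  | succ k ih =>
    rw [pow_succ', Module.End.mul_apply, ih, ← nsmul_eq_mul, map_nsmul, h1, Nat.descFactorial_succ,
      nsmul_eq_mul, Nat.sub_sub]
    push_cast
    ring

/-- The coefficient functionals of `⨁ Q x ^ l` in the algebra generated by `x` and a
derivation-like operator. -/
lemma exists_coeff_operator (p : ℕ) [hp : Fact p.Prime] [CharP K p]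
    {S : Subalgebra K (Module.End K R)}
    {D : Module.End K R} {x : R} (hxS : Algebra.lmul K R x ∈ S) (hDS : D ∈ S) (hD1 : D 1 = 0)
    (hDx : ∀ f, D (x * f) = x * D f + f) {m : ℕ} (hm : m < p) :
    ∃ T ∈ S, ∀ q : R, (∀ f, D (q * f) = q * D f) → ∀ l < p, T (q * x ^ l) = if l = m then q else 0 := by
  have hfac {k : ℕ} (hk : k < p) : ((k.factorial : ℕ) : K) ≠ 0 := by
    rw [Ne, CharP.cast_eq_zero_iff K p, hp.out.dvd_factorial]
    omega
  have hcast (k : ℕ) : ((k : ℕ) : R) = algebraMap K R k := by simp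
  have hp1 : p - 1 < p := Nat.sub_lt hp.out.pos one_pos
  refine ⟨((m.factorial : K)⁻¹ * ((p - 1).factorial : K)⁻¹) •
    (D ^ (p - 1) * Algebra.lmul K R x ^ (p - 1) * D ^ m),
    S.smul_mem (S.mul_mem (S.mul_mem (S.pow_mem hDS _) (S.pow_mem hxS _)) (S.pow_mem hDS _)) _,
    fun q hq l hl => ?_⟩
  rw [LinearMap.smul_apply, Module.End.mul_apply, Module.End.mul_apply,
    pow_apply_mul_pow hD1 hDx hq, ← map_pow, Algebra.coe_lmul_eq_mul, LinearMap.mul_apply_apply,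
    show x ^ (p - 1) * ((l.descFactorial m : R) * (q * x ^ (l - m))) =
      (l.descFactorial m : R) * (q * x ^ (p - 1 + (l - m))) by rw [pow_add]; ring,
    ← nsmul_eq_mul, map_nsmul, pow_apply_mul_pow hD1 hDx hq, nsmul_eq_mul]
  split_ifs with h
  · subst h
    rw [Nat.sub_self, add_zero, Nat.sub_self, pow_zero, mul_one, Nat.descFactorial_self,
      Nat.descFactorial_self, hcast, hcast, Algebra.smul_def, ← mul_assoc, ← mul_assoc, ← map_mul,
      ← map_mul]
    have h1 := hfac hl
    have h2 := hfac hp1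
    rw [show (l.factorial : K)⁻¹ * ((p - 1).factorial : K)⁻¹ * (l.factorial : K) *
      ((p - 1).factorial : K) = 1 by field_simp, map_one, one_mul]
  · rcases lt_or_gt_of_ne h with h | h
    · simp [Nat.descFactorial_eq_zero_iff_lt.2 h]
    · have h1 := Nat.factorial_mul_descFactorial (Nat.le_add_right (p - 1) (l - m))
      have h2 : p ∣ (p - 1 + (l - m)).factorial := hp.out.dvd_factorial.2 (by omega)
      rw [← h1, Nat.add_sub_cancel_left, hp.out.dvd_mul, hp.out.dvd_factorial] at h2
      have h3 : p ∣ (p - 1 + (l - m)).descFactorial (p - 1) := h2.resolve_left (by omega)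
      rw [hcast ((p - 1 + (l - m)).descFactorial (p - 1)),
        (CharP.cast_eq_zero_iff K p _).2 h3, map_zero, zero_mul, mul_zero, smul_zero]

open Algebra in
lemma exists_eq_sum_mul_pow {p : ℕ} (hp : 0 < p) {s : Set R} {x : R} (hx : x ^ p ∈ adjoin K s) {f : R}
    (hf : f ∈ adjoin K (s ∪ {x})) : ∃ q : Fin p → adjoin K s, f = ∑ l, (q l : R) * x ^ (l : ℕ) := by
  classical
  let P : Polynomial (adjoin K s) := Polynomial.X ^ p - Polynomial.C ⟨x ^ p, hx⟩
  nontriviality R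
  have hdeg : P.natDegree = p := Polynomial.natDegree_X_pow_sub_C
  have h := Submodule.span_range_natDegree_eq_adjoin (R := adjoin K s) (x := x) (f := P)
    (Polynomial.monic_X_pow_sub_C _ hp.ne') (by simp [P])
  rw [adjoin_union_eq_adjoin_adjoin, Subalgebra.mem_restrictScalars, ← Subalgebra.mem_toSubmodule,
    ← h, hdeg, Finset.coe_image, Submodule.mem_span_image_finset_iff_exists_fun'] at hf
  obtain ⟨q, rfl⟩ := hf
  refine ⟨fun l => q l, ?_⟩
  rw [Finset.sum_range]
  rfl

open Algebra in
/-- A commutative algebra obtained by successively adjoining `p`-th roots, with a compatible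
system of operators behaving like derivations, has the expected dimension, and its functionals are
realized by operators. -/
lemma finrank_adjoin_and_exists_operator (p : ℕ) [hp : Fact p.Prime] [CharP K p] [Nontrivial R]
    {S : Subalgebra K (Module.End K R)} {N : ℕ} {x : Fin N → R} {D : Fin N → Module.End K R}
    (hxS : ∀ t, Algebra.lmul K R (x t) ∈ S) (hDS : ∀ t, D t ∈ S) (hD1 : ∀ t, D t 1 = 0)
    (hDx : ∀ t f, D t (x t * f) = x t * D t f + f)
    (hDlt : ∀ s t f, s < t → D t (x s * f) = x s * D t f)
    (hxp : ∀ t, x t ^ p ∈ adjoin K (x '' {s | s < t})) (k : ℕ) (hk : k ≤ N) :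
    FiniteDimensional K (adjoin K (x '' {s | s.val < k})) ∧
      Module.finrank K (adjoin K (x '' {s | s.val < k})) = p ^ k ∧
      ∀ φ : adjoin K (x '' {s | s.val < k}) →ₗ[K] K, ∃ T ∈ S, ∀ f : adjoin K (x '' {s | s.val < k}), T (f : R) = φ f • (1 : R) := by
  induction k with
  | zero =>
    have h0 : adjoin K (x '' {s | s.val < 0}) = ⊥ := by simp
    rw [h0]
    refine ⟨inferInstance, by simp, fun φ => ⟨algebraMap K _ (φ 1), S.algebraMap_mem _, ?_⟩⟩
    rintro ⟨f, hf⟩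
    obtain ⟨a, rfl⟩ := Algebra.mem_bot.1 hf
    have : (⟨algebraMap K R a, hf⟩ : (⊥ : Subalgebra K R)) = a • 1 := by
      ext; simp [Algebra.smul_def]
    rw [this, map_smul, Module.algebraMap_end_apply, smul_eq_mul, mul_comm, mul_smul]
    rfl
  | succ k ih =>
    obtain ⟨hfin, hrank, hop⟩ := ih (Nat.le_of_succ_le hk)
    set s : Set R := x '' {s | s.val < k} with hs
    set t : Fin N := ⟨k, hk⟩ with ht
    have hset : x '' {s | s.val < k + 1} = s ∪ {x t} := by
      rw [hs, ← Set.image_singleton, ← Set.image_union]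
      congr 1
      ext r
      simp [ht, Fin.ext_iff, le_iff_lt_or_eq, or_comm]
    rw [hset]
    have hxt : x t ^ p ∈ adjoin K s := hxp t
    have hq (q : R) (hqs : q ∈ adjoin K s) (f : R) : D t (q * f) = q * D t f := by
      induction hqs using adjoin_induction generalizing f with
      | mem y hy =>
        obtain ⟨r, hr, rfl⟩ := hy
        exact hDlt r t f hr
      | algebraMap a => simp [← Algebra.smul_def]
      | add y z _ _ hy hz => simp [add_mul, hy, hz]
      | mul y z _ _ hy hz => rw [mul_assoc, hy, hz, mul_assoc]
    have hcoef (m : Fin p) := exists_coeff_operator p (hxS t) (hDS t) (hD1 t) (hDx t) m.2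
    choose E hES hE using hcoef
    have hE' (m : Fin p) (q : Fin p → adjoin K s) : E m (∑ l, (q l : R) * x t ^ (l : ℕ)) = q m := by
      rw [map_sum, Finset.sum_eq_single m]
      · rw [hE m _ (hq _ (q m).2) _ m.2, if_pos rfl]
      · intro l _ hl
        rw [hE m _ (hq _ (q l).2) _ l.2, if_neg (fun h => hl (Fin.ext h))]
      · simp
    have hmem (q : Fin p → adjoin K s) :
        ∑ l, (q l : R) * x t ^ (l : ℕ) ∈ adjoin K (s ∪ {x t}) :=
      Subalgebra.sum_mem _ fun l _ => Subalgebra.mul_mem _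
        (adjoin_mono Set.subset_union_left (q l).2)
        (Subalgebra.pow_mem _ (subset_adjoin (Set.mem_union_right s (Set.mem_singleton _))) _)
    let Φ : (Fin p → adjoin K s) →ₗ[K] adjoin K (s ∪ {x t}) :=
      { toFun := fun q => ⟨∑ l, (q l : R) * x t ^ (l : ℕ), hmem q⟩
        map_add' := fun q q' => by ext; simp [add_mul, Finset.sum_add_distrib]
        map_smul' := fun a q => by ext; simp [Finset.smul_sum] }
    have hΦ : Function.Bijective Φ := by
      refine ⟨fun q q' h => ?_, fun ⟨f, hf⟩ => ?_⟩
      · ext m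
        rw [← hE' m q, ← hE' m q']
        exact congrArg (E m) (congrArg Subtype.val h)
      · obtain ⟨q, rfl⟩ := exists_eq_sum_mul_pow hp.out.pos hxt hf
        exact ⟨q, rfl⟩
    let e := LinearEquiv.ofBijective Φ hΦ
    refine ⟨Module.Finite.equiv e, ?_, fun φ => ?_⟩
    · rw [← e.finrank_eq, Module.finrank_pi_fintype]
      simp [hrank, pow_succ']
    · choose T hTS hT using fun m => hop ((φ.comp Φ).comp (LinearMap.single K (fun _ => adjoin K s) m))
      refine ⟨∑ m, T m * E m, S.sum_mem fun m _ => S.mul_mem (hTS m) (hES m), fun f => ?_⟩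
      obtain ⟨q, rfl⟩ := hΦ.2 f
      rw [LinearMap.sum_apply]
      have : φ (Φ q) = ∑ m, φ (Φ (Pi.single m (q m))) := by
        rw [← map_sum, ← map_sum, Finset.univ_sum_single]
      rw [this, Finset.sum_smul]
      refine Finset.sum_congr rfl fun m _ => ?_
      rw [Module.End.mul_apply]
      erw [hE' m q]
      exact hT m (q m)

open Algebra in
lemma finrank_and_eq_top_of_operators (p : ℕ) [hp : Fact p.Prime] [CharP K p] [Nontrivial R]
    {S : Subalgebra K (Module.End K R)} {ι : Type*} [Fintype ι] [LinearOrder ι] {x : ι → R}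
    {D : ι → Module.End K R}
    (hS : ∀ r, Algebra.lmul K R r ∈ S) (hDS : ∀ t, D t ∈ S) (hD1 : ∀ t, D t 1 = 0)
    (hDx : ∀ t f, D t (x t * f) = x t * D t f + f)
    (hDlt : ∀ s t f, s < t → D t (x s * f) = x s * D t f)
    (hxp : ∀ t, x t ^ p ∈ adjoin K (x '' {s | s < t})) (htop : adjoin K (Set.range x) = ⊤) :
    FiniteDimensional K R ∧ Module.finrank K R = p ^ Fintype.card ι ∧ S = ⊤ := by
  let e : Fin (Fintype.card ι) ≃o ι := Fintype.orderIsoFinOfCardEq ι rfl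
  obtain ⟨hfin, hrank, hop⟩ := finrank_adjoin_and_exists_operator p (S := S) (x := x ∘ e) (D := D ∘ e)
    (fun t => hS _) (fun t => hDS _) (fun t => hD1 _) (fun t => hDx _)
    (fun s t f hst => hDlt _ _ _ (e.lt_iff_lt.2 hst)) (fun t => by
      have : x ∘ e '' {s | s < t} = x '' {s | s < e t} := by
        rw [Set.image_comp]
        congr 1
        ext r
        refine ⟨?_, fun h => ⟨e.symm r, by simpa [e.symm_apply_lt] using h, e.apply_symm_apply r⟩⟩
        rintro ⟨s, hs, rfl⟩
        exact e.lt_iff_lt.2 hs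
      rw [this]
      exact hxp _) _ le_rfl
  have huniv : x ∘ e '' {s | s.val < Fintype.card ι} = Set.range x := by
    have : {s : Fin (Fintype.card ι) | s.val < Fintype.card ι} = Set.univ := by ext s; simp
    rw [this, Set.image_univ, e.surjective.range_comp]
  rw [huniv, htop] at hfin hrank hop
  rw [Subalgebra.topEquiv.toLinearEquiv.finrank_eq] at hrank
  have hR : FiniteDimensional K R := Module.Finite.equiv (Subalgebra.topEquiv (R := K) (A := R)).toLinearEquiv
  refine ⟨hR, hrank, eq_top_iff.2 fun T _ => ?_⟩
  let b := Module.finBasis K R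
  choose U hUS hU using fun i => hop ((b.coord i).comp (Subalgebra.topEquiv (R := K) (A := R)).toLinearMap)
  have : T = ∑ i, Algebra.lmul K R (T (b i)) * U i := by
    refine LinearMap.ext fun f => ?_
    conv_lhs => rw [← b.sum_repr f, map_sum]
    rw [LinearMap.sum_apply]
    refine Finset.sum_congr rfl fun i _ => ?_
    have := hU i ⟨f, trivial⟩
    rw [Module.End.mul_apply, show (U i) f = _ from this]
    simp
  rw [this]
  exact S.sum_mem fun i _ => S.mul_mem (hS _) (hUS _)

end Density

section Stability

/-- The commutation relation between the `i`-th and `j`-th members of two sequences prescribed by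
the polynomial `c_{p^i,p^j}`. -/
def WittCommRel {A : Type*} [Ring A] (p : ℕ) (c : ℕ+ → ℕ+ → MvPolynomial (ℕ+ ⊕ₗ ℕ+) ℤ)
    (x y : ℕ → A) (i j : ℕ) : Prop :=
  y j * x i = x i * y j + cEval (fun d => x (padicValNat p d)) (fun e => y (padicValNat p e))
    (c (ppow p i) (ppow p j))

lemma WittCommRel.map {A B : Type*} [Ring A] [Ring B] {p : ℕ}
    {c : ℕ+ → ℕ+ → MvPolynomial (ℕ+ ⊕ₗ ℕ+) ℤ} {x y : ℕ → A} {i j : ℕ}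
    (h : WittCommRel p c x y i j) (f : A →+* B) :
    WittCommRel p c (fun i => f (x i)) (fun j => f (y j)) i j := by
  have := congrArg f h
  rwa [map_mul, map_add, map_mul, map_cEval] at this

variable {R M : Type*} [CommRing R] [AddCommGroup M] [Module R M]

/-- The algebra of endomorphisms preserving a submodule. -/
def Submodule.preserving (W : Submodule R M) : Subalgebra R (Module.End R M) where
  carrier := {T | ∀ w ∈ W, T w ∈ W}
  mul_mem' hS hT w hw := hS _ (hT w hw)
  add_mem' hS hT w hw := W.add_mem (hS w hw) (hT w hw)
  algebraMap_mem' r _ hw := W.smul_mem r hw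

lemma WittCommRel.of_map {A B : Type*} [Ring A] [Ring B] {p : ℕ}
    {c : ℕ+ → ℕ+ → MvPolynomial (ℕ+ ⊕ₗ ℕ+) ℤ} {x y : ℕ → A} {i j : ℕ} {f : A →+* B}
    (hf : Function.Injective f)
    (h : WittCommRel p c (fun i => f (x i)) (fun j => f (y j)) i j) : WittCommRel p c x y i j := by
  apply hf
  rwa [map_mul, map_add, map_mul, map_cEval]

/-- The restriction of the endomorphisms preserving a submodule. -/
def Submodule.restrictPreserving (W : Submodule R M) : W.preserving →ₐ[R] Module.End R W where
  toFun T := T.1.restrict T.2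
  map_one' := rfl
  map_mul' _ _ := rfl
  map_zero' := rfl
  map_add' _ _ := rfl
  commutes' _ := rfl

lemma IsCFamily.mem_preserving {p : ℕ} [Fact p.Prime] {c : ℕ+ → ℕ+ → MvPolynomial (ℕ+ ⊕ₗ ℕ+) ℤ}
    (hc : IsCFamily c) {I J : Set ℕ} (hI : IsLowerSet I) (hJ : IsLowerSet J)
    {X Y : ℕ → Module.End R M} (hXY : ∀ i ∈ I, ∀ j ∈ J, WittCommRel p c X Y i j)
    {W : Submodule R M} (hX : ∀ i ∈ I, X i ∈ W.preserving) {V : Set M}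
    (hind : ∀ W' : Submodule R M, V ⊆ W' → (∀ i ∈ I, ∀ w ∈ W', w ∈ W → X i w ∈ W') → W ≤ W')
    (hYV : ∀ j ∈ J, ∀ v ∈ V, Y j v ∈ W) {j : ℕ} (hj : j ∈ J) : Y j ∈ W.preserving := by
  induction j using Nat.strong_induction_on with
  | _ j ih =>
    refine hind (W.comap (Y j)) (fun v hv => hYV j hj v hv) fun i hi w hw hwW => ?_
    have h := congrArg (fun T => T w) (hXY i hi j hj)
    simp only [Module.End.mul_apply, LinearMap.add_apply] at h
    rw [Submodule.mem_comap, h]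
    refine W.add_mem (hX i hi _ hw) ?_
    refine hc.cEval_ppow_mem p W.preserving.toSubring ?_ ?_ w hwW
    · intro r hr
      simpa [padicValNat_ppow] using hX r (hI hr.le hi)
    · intro r hr
      simpa [padicValNat_ppow] using ih r hr (hJ hr.le hj)

lemma Algebra.toSubmodule_adjoin_le {B : Type*} [CommRing B] [Algebra R B] {s : Set B}
    {W : Submodule R B} (h1 : 1 ∈ W)
    (hs : ∀ b ∈ s, ∀ w ∈ W, w ∈ Algebra.adjoin R s → b * w ∈ W) :
    Subalgebra.toSubmodule (Algebra.adjoin R s) ≤ W := by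
  have h {r : B} (hr : r ∈ Algebra.adjoin R s) : ∀ w ∈ W ⊓ Subalgebra.toSubmodule (Algebra.adjoin R s),
      r * w ∈ W ⊓ Subalgebra.toSubmodule (Algebra.adjoin R s) := by
    have hle : Algebra.adjoin R s ≤
        (W ⊓ Subalgebra.toSubmodule (Algebra.adjoin R s)).preserving.comap (Algebra.lmul R B) :=
      Algebra.adjoin_le fun b hb w hw =>
        ⟨hs b hb w hw.1 hw.2, Subalgebra.mul_mem _ (Algebra.subset_adjoin hb) hw.2⟩
    exact hle hr
  intro r hr
  simpa using (h hr 1 ⟨h1, one_mem (Algebra.adjoin R s)⟩).1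

lemma Subalgebra.lmul_mem_preserving {B : Type*} [CommRing B] [Algebra R B] {S : Subalgebra R B}
    {b : B} (hb : b ∈ S) : Algebra.lmul R B b ∈ (Subalgebra.toSubmodule S).preserving :=
  fun _ hw => S.mul_mem hb hw

lemma IsCFamily.mem_preserving_adjoin {p : ℕ} [Fact p.Prime]
    {c : ℕ+ → ℕ+ → MvPolynomial (ℕ+ ⊕ₗ ℕ+) ℤ} (hc : IsCFamily c) {B : Type*} [CommRing B]
    [Algebra R B] {I J : Set ℕ} (hI : IsLowerSet I) (hJ : IsLowerSet J) {x : ℕ → B}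
    {Y : ℕ → Module.End R B}
    (hxY : ∀ i ∈ I, ∀ j ∈ J, WittCommRel p c (fun i => Algebra.lmul R B (x i)) Y i j) {s : Set B}
    (hxs : ∀ i ∈ I, x i ∈ s)
    (hs : ∀ b ∈ s, (∃ i ∈ I, x i = b) ∨ ∀ j ∈ J, Commute (Y j) (Algebra.lmul R B b))
    (hY1 : ∀ j ∈ J, Y j 1 ∈ Algebra.adjoin R s) {j : ℕ} (hj : j ∈ J) :
    Y j ∈ (Subalgebra.toSubmodule (Algebra.adjoin R s)).preserving := by
  induction j using Nat.strong_induction_on with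
  | _ j ih =>
    set S := Algebra.adjoin R s with hS
    have hsS {b : B} (hb : b ∈ s) : Algebra.lmul R B b ∈ (Subalgebra.toSubmodule S).preserving :=
      Subalgebra.lmul_mem_preserving (Algebra.subset_adjoin hb)
    refine Algebra.toSubmodule_adjoin_le (W := (Subalgebra.toSubmodule S).comap (Y j)) (hY1 j hj) ?_
    intro b hb w hw hwS
    rw [Submodule.mem_comap, ← LinearMap.mul_apply_apply (R := R), ← Algebra.coe_lmul_eq_mul,
      ← Module.End.mul_apply]
    obtain ⟨i, hi, rfl⟩ | h := hs b hb
    · rw [hxY i hi j hj]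
      refine Submodule.add_mem _ (hsS hb _ hw) (hc.cEval_ppow_mem p
        (Subalgebra.toSubmodule S).preserving.toSubring ?_ ?_ w hwS)
      · intro r hr
        simpa [padicValNat_ppow] using hsS (hxs r (hI hr.le hi))
      · intro r hr
        simpa [padicValNat_ppow] using ih r hr (hJ hr.le hj)
    · rw [(h j hj).eq]
      exact hsS hb _ hw

end Stability

section DimensionBound

variable {K A : Type*} [Field K] [Ring A] [Algebra K A]

lemma span_prod_pow_eq_top {B ι : Type*} [CommRing B] [Algebra K B] [Fintype ι] {q : ℕ} (hq : 0 < q)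
    {z : ι → B} {a : ι → K} (hz : ∀ i, z i ^ q = algebraMap K B (a i))
    (htop : Algebra.adjoin K (Set.range z) = ⊤) :
    Submodule.span K (Set.range fun f : ι → Fin q => ∏ i, z i ^ (f i : ℕ)) = ⊤ := by
  refine eq_top_iff.2 fun b _ => ?_
  have hb : b ∈ Algebra.adjoin K (Set.range z) := htop ▸ trivial
  rw [Algebra.adjoin_range_eq_range_aeval] at hb
  obtain ⟨P, rfl⟩ := hb
  change MvPolynomial.aeval z P ∈ _
  rw [MvPolynomial.aeval_def, MvPolynomial.eval₂_eq']
  refine Submodule.sum_mem _ fun e _ => ?_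
  have h (i : ι) : z i ^ e i = a i ^ (e i / q) • z i ^ (e i % q) := by
    rw [Algebra.smul_def, map_pow, ← hz, ← pow_mul, ← pow_add, Nat.div_add_mod]
  rw [← Algebra.smul_def, Finset.prod_congr rfl fun i _ => h i, Finset.prod_smul]
  exact Submodule.smul_mem _ _ (Submodule.smul_mem _ _
    (Submodule.subset_span ⟨fun i => ⟨e i % q, Nat.mod_lt _ hq⟩, rfl⟩))

open scoped IsMulCommutative in
lemma finrank_adjoin_le_of_commute {ι : Type*} [Fintype ι] {q : ℕ} (hq : 0 < q)
    {z : ι → A} {a : ι → K} (hcomm : ∀ i j, Commute (z i) (z j))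
    (hz : ∀ i, z i ^ q = algebraMap K A (a i)) :
    FiniteDimensional K (Algebra.adjoin K (Set.range z)) ∧
      Module.finrank K (Algebra.adjoin K (Set.range z)) ≤ q ^ Fintype.card ι := by
  classical
  have : IsMulCommutative (Algebra.adjoin K (Set.range z)) :=
    Algebra.isMulCommutative_adjoin K (by rintro _ ⟨i, rfl⟩ _ ⟨j, rfl⟩; exact hcomm i j)
  let z' : ι → Algebra.adjoin K (Set.range z) := fun i => ⟨z i, Algebra.subset_adjoin ⟨i, rfl⟩⟩
  have htop : Algebra.adjoin K (Set.range z') = ⊤ := by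
    rw [← Algebra.adjoin_adjoin_coe_preimage (s := Set.range z)]
    congr 1
    ext b
    simp [z', Subtype.ext_iff]
  have hspan := span_prod_pow_eq_top hq (z := z') (a := a) (fun i => Subtype.ext (hz i)) htop
  refine ⟨⟨⟨Finset.univ.image fun f : ι → Fin q => ∏ i, z' i ^ (f i : ℕ), by simpa using hspan⟩⟩, ?_⟩
  rw [← finrank_top, ← hspan]
  exact (finrank_range_le_card _).trans (by simp)

lemma IsCFamily.finrank_le {p : ℕ} [Fact p.Prime] {c : ℕ+ → ℕ+ → MvPolynomial (ℕ+ ⊕ₗ ℕ+) ℤ}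
    (hc : IsCFamily c) {n q : ℕ} (hq : 0 < q) {x y : ℕ → A} {a b : ℕ → K}
    (hx : ∀ i < n, ∀ j < n, Commute (x i) (x j)) (hy : ∀ i < n, ∀ j < n, Commute (y i) (y j))
    (hxa : ∀ i < n, x i ^ q = algebraMap K A (a i)) (hyb : ∀ i < n, y i ^ q = algebraMap K A (b i))
    (hxy : ∀ i < n, ∀ j < n, WittCommRel p c x y i j)
    (htop : Algebra.adjoin K (x '' Set.Iio n ∪ y '' Set.Iio n) = ⊤) :
    FiniteDimensional K A ∧ Module.finrank K A ≤ q ^ n * q ^ n := by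
  have hrange (x : ℕ → A) : x '' Set.Iio n = Set.range fun i : Fin n => x i := by
    ext a
    simp [Fin.exists_iff]
  set CX := Algebra.adjoin K (x '' Set.Iio n) with hCX
  set CY := Algebra.adjoin K (y '' Set.Iio n) with hCY
  have hxX {i : ℕ} (hi : i < n) : x i ∈ CX := Algebra.subset_adjoin ⟨i, hi, rfl⟩
  have hyY {i : ℕ} (hi : i < n) : y i ∈ CY := Algebra.subset_adjoin ⟨i, hi, rfl⟩
  obtain ⟨fX, rX⟩ := finrank_adjoin_le_of_commute hq (z := fun i : Fin n => x i) (a := fun i => a i)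
    (fun i j => hx i i.2 j j.2) (fun i => hxa i i.2)
  obtain ⟨fY, rY⟩ := finrank_adjoin_le_of_commute hq (z := fun i : Fin n => y i) (a := fun i => b i)
    (fun i j => hy i i.2 j j.2) (fun i => hyb i i.2)
  rw [← hrange, ← hCX] at fX rX
  rw [← hrange, ← hCY] at fY rY
  set W := Subalgebra.toSubmodule CX * Subalgebra.toSubmodule CY with hW
  have hCYW {s : A} (hs : s ∈ CY) : s ∈ W := by
    rw [← one_mul s]
    exact Submodule.mul_mem_mul (M := Subalgebra.toSubmodule CX) (N := Subalgebra.toSubmodule CY)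
      (one_mem CX) hs
  have hXW {i : ℕ} (hi : i < n) : Algebra.lmul K A (x i) ∈ W.preserving := by
    intro w hw
    induction hw using Submodule.mul_induction_on' with
    | mem_mul_mem r hr s hs =>
      simp only [Algebra.coe_lmul_eq_mul, LinearMap.mul_apply_apply, ← mul_assoc]
      exact Submodule.mul_mem_mul (CX.mul_mem (hxX hi) hr) hs
    | add r _ s _ hr hs => rw [map_add]; exact W.add_mem hr hs
  have hYW {j : ℕ} (hj : j ∈ Set.Iio n) : Algebra.lmul K A (y j) ∈ W.preserving := by
    refine hc.mem_preserving (p := p) (isLowerSet_Iio n) (isLowerSet_Iio n)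
      (X := fun i => Algebra.lmul K A (x i)) (Y := fun i => Algebra.lmul K A (y i))
      (fun i hi j hj => (hxy i hi j hj).map (Algebra.lmul K A).toRingHom) (fun i hi => hXW hi) (V := CY)
      (fun W' hVW' hW' => ?_) (fun j hj v hv => ?_) hj
    · refine Submodule.mul_le.2 fun r hr s hs => ?_
      suffices h : ∀ w, w ∈ W' → w ∈ W → r * w ∈ W' ∧ r * w ∈ W by
        refine (h s (hVW' hs) ?_).1
        exact hCYW hs
      clear hs s
      rw [Subalgebra.mem_toSubmodule] at hr
      induction hr using Algebra.adjoin_induction with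
      | mem r hr =>
        obtain ⟨i, hi, rfl⟩ := hr
        exact fun w hw hwW => ⟨hW' i hi w hw hwW, hXW hi w hwW⟩
      | algebraMap a =>
        intro w hw hwW
        rw [← Algebra.smul_def]
        exact ⟨W'.smul_mem _ hw, W.smul_mem _ hwW⟩
      | add r s _ _ hr hs =>
        intro w hw hwW
        rw [add_mul]
        exact ⟨W'.add_mem (hr w hw hwW).1 (hs w hw hwW).1, W.add_mem (hr w hw hwW).2 (hs w hw hwW).2⟩
      | mul r s _ _ hr hs =>
        intro w hw hwW
        rw [mul_assoc]
        exact hr _ (hs w hw hwW).1 (hs w hw hwW).2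
    · exact hCYW (CY.mul_mem (hyY hj) hv)
  have hWtop : W = ⊤ := by
    refine eq_top_iff.2 fun r _ => ?_
    have hr : r ∈ (W.preserving.comap (Algebra.lmul K A)) := by
      have : Algebra.adjoin K (x '' Set.Iio n ∪ y '' Set.Iio n) ≤ W.preserving.comap (Algebra.lmul K A) := by
        refine Algebra.adjoin_le ?_
        rintro _ (⟨i, hi, rfl⟩ | ⟨i, hi, rfl⟩)
        · exact hXW hi
        · exact hYW hi
      exact this (htop ▸ trivial)
    simpa using hr 1 (hCYW (one_mem CY))
  have hrg := Submodule.mulMap_range (R := K) (Subalgebra.toSubmodule CX) (Subalgebra.toSubmodule CY)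
  rw [← hW, hWtop] at hrg
  refine ⟨Module.Finite.of_surjective _ (LinearMap.range_eq_top.1 hrg), ?_⟩
  rw [← finrank_top K A, ← hrg]
  refine (LinearMap.finrank_range_le _).trans ?_
  rw [Module.finrank_tensorProduct]
  simp only [Fintype.card_fin] at rX rY
  exact Nat.mul_le_mul rX rY

end DimensionBound

section IntegralModel

open MvPolynomial

lemma WittVector.coeff_mul_mem {p : ℕ} [Fact p.Prime] {A : Type*} [CommRing A] (S : Subring A)
    {x y : WittVector p A} (hx : ∀ i, x.coeff i ∈ S) (hy : ∀ i, y.coeff i ∈ S) (i : ℕ) :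
    (x * y).coeff i ∈ S := by
  have h (z : WittVector p A) (hz : ∀ i, z.coeff i ∈ S) :
      WittVector.map S.subtype (WittVector.mk p fun i => ⟨z.coeff i, hz i⟩) = z := by
    ext i
    simp [WittVector.map_coeff]
  rw [← h x hx, ← h y hy, ← map_mul, WittVector.map_coeff]
  exact Subtype.property _

lemma WittVector.bind₁_xInTermsOfW_ghost {p : ℕ} [Fact p.Prime] {A : Type*} [CommRing A] [Algebra ℚ A]
    (x : WittVector p A) (i : ℕ) :
    aeval (fun k => WittVector.ghostComponent k x) (xInTermsOfW p ℚ i) = x.coeff i := by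
  have h := congrArg (aeval (R := ℚ) x.coeff) (bind₁_wittPolynomial_xInTermsOfW p ℚ i)
  rw [aeval_X, aeval_bind₁] at h
  rw [← h]
  congr 2
  funext k
  rw [WittVector.ghostComponent_apply, ← aeval_map_algebraMap ℚ, map_wittPolynomial]

namespace TripleLattice

/-- The polynomial ring in three big families of ghost components. -/
abbrev GhostRing : Type := MvPolynomial (Fin 3 × ℕ+) ℚ

/-- The polynomial ring in the components of three universal `p`-typical Witt vectors. -/
abbrev WittRing : Type := MvPolynomial (Fin 3 × ℕ) ℤ

/-- Multiplication by the `k`-th ghost component of the `ε`-th family. -/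
def ghostX (ε : Fin 3) (k : ℕ+) : Module.End ℚ GhostRing := Algebra.lmul ℚ GhostRing (X (ε, k))

/-- The operators conjugate to the ghost components, twisted by the products of the ghost
components of the other two families. -/
def ghostY (ε : Fin 3) (k : ℕ+) : Module.End ℚ GhostRing :=
  (k : ℚ) • (pderiv (ε, k)).toLinearMap +
    Algebra.lmul ℚ GhostRing (X (ε + 1, k) * X (ε + 2, k))

lemma ghostX_apply (ε : Fin 3) (k : ℕ+) (f : GhostRing) : ghostX ε k f = X (ε, k) * f := rfl

lemma ghostY_apply (ε : Fin 3) (k : ℕ+) (f : GhostRing) :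
    ghostY ε k f = (k : GhostRing) * pderiv (ε, k) f + X (ε + 1, k) * X (ε + 2, k) * f := by
  simp [ghostY, Algebra.smul_def]

lemma commute_ghostX (ε δ : Fin 3) (k l : ℕ+) : Commute (ghostX ε k) (ghostX δ l) :=
  (Commute.all _ _).map (Algebra.lmul ℚ GhostRing)

lemma ghostY_mul_ghostX (ε : Fin 3) (k l : ℕ+) :
    ghostY ε l * ghostX ε k = ghostX ε k * ghostY ε l +
      if k = l then ((k : ℕ) : Module.End ℚ GhostRing) else 0 := by
  refine LinearMap.ext fun f => ?_
  simp only [Module.End.mul_apply, LinearMap.add_apply, ghostY_apply, ghostX_apply,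
    Derivation.leibniz, pderiv_X, smul_eq_mul]
  by_cases h : k = l
  · subst h
    simp [Module.End.natCast_apply]
    ring
  · simp [h]
    ring

lemma commute_ghostY_ghostX {ε δ : Fin 3} (h : ε ≠ δ) (k l : ℕ+) :
    Commute (ghostY ε l) (ghostX δ k) := by
  refine LinearMap.ext fun f => ?_
  simp only [Module.End.mul_apply, ghostY_apply, ghostX_apply, Derivation.leibniz, pderiv_X,
    smul_eq_mul]
  simp [h.symm]
  ring

lemma pderiv_comm (v w : Fin 3 × ℕ+) (f : GhostRing) :
    pderiv v (pderiv w f) = pderiv w (pderiv v f) := by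
  have h : ⁅(pderiv v : Derivation ℚ GhostRing GhostRing), (pderiv w : Derivation ℚ GhostRing GhostRing)⁆ = 0 := by
    refine derivation_ext fun u => ?_
    rw [Derivation.commutator_apply, pderiv_X, pderiv_X, Pi.single_apply, Pi.single_apply]
    split_ifs <;> simp
  rw [← sub_eq_zero, ← Derivation.commutator_apply, h, Derivation.zero_apply]

lemma commute_ghostY (ε δ : Fin 3) (k l : ℕ+) : Commute (ghostY ε k) (ghostY δ l) := by
  refine LinearMap.ext fun f => ?_
  simp only [Module.End.mul_apply, ghostY_apply, Derivation.leibniz, pderiv_X, map_add,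
    Derivation.map_natCast, smul_eq_mul, pderiv_comm (δ, l)]
  by_cases h : k = l
  · subst h
    fin_cases ε <;> fin_cases δ <;> simp <;> ring
  · have h' := Ne.symm h
    simp [h, h']
    ring

variable (p : ℕ) [hp : Fact p.Prime]

/-- The Witt components attached to the ghost components, as an embedding of the integral polynomial
ring. -/
def toGhostRing : WittRing →+* GhostRing :=
  eval₂Hom (Int.castRingHom GhostRing)
    fun v => rename (fun k => (v.1, ppow p k)) (xInTermsOfW p ℚ v.2)

lemma toGhostRing_X (v : Fin 3 × ℕ) :
    toGhostRing p (X v) = rename (fun k => (v.1, ppow p k)) (xInTermsOfW p ℚ v.2) := by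
  simp [toGhostRing]

lemma toGhostRing_injective : Function.Injective (toGhostRing p) := by
  let ψ : GhostRing →ₐ[ℚ] MvPolynomial (Fin 3 × ℕ) ℚ :=
    aeval fun v => rename (Prod.mk v.1) (wittPolynomial p ℚ (padicValNat p v.2))
  have h : ψ.toRingHom.comp (toGhostRing p) = map (Int.castRingHom ℚ) := by
    refine ringHom_ext (fun r => by simp) fun v => ?_
    have h1 := congrArg (rename (R := ℚ) (Prod.mk v.1)) (bind₁_wittPolynomial_xInTermsOfW p ℚ v.2)
    rw [rename_bind₁, rename_X] at h1
    simp only [AlgHom.toRingHom_eq_coe, RingHom.comp_apply, toGhostRing_X, RingHom.coe_coe, map_X, ψ,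
      aeval_rename]
    rw [← h1, bind₁]
    simp [Function.comp_def, padicValNat_ppow]
  have hinj := map_injective (σ := Fin 3 × ℕ) _ (RingHom.injective_int (Int.castRingHom ℚ))
  rw [← h, RingHom.coe_comp] at hinj
  exact hinj.of_comp

/-- Multiplication by the Witt components. -/
def wittX (ε : Fin 3) (i : ℕ) : Module.End ℚ GhostRing :=
  wittOfGhost p (ghostX ε ∘ ppow p) (fun _ _ => commute_ghostX _ _ _ _) i

/-- The operators conjugate to the Witt components. -/
def wittY (ε : Fin 3) (i : ℕ) : Module.End ℚ GhostRing :=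
  wittOfGhost p (ghostY ε ∘ ppow p) (fun _ _ => commute_ghostY _ _ _ _) i

lemma wittX_eq (ε : Fin 3) (i : ℕ) :
    wittX p ε i = Algebra.lmul ℚ GhostRing (toGhostRing p (X (ε, i))) := by
  have h : (ncAeval (ghostX ε ∘ ppow p) (fun _ _ => commute_ghostX _ _ _ _)) =
      (Algebra.lmul ℚ GhostRing).comp (rename fun k => (ε, ppow p k)) := by
    refine algHom_ext fun k => ?_
    rw [ncAeval_X]
    simp [ghostX]
  rw [toGhostRing_X]
  exact DFunLike.congr_fun h _

lemma commute_wittY (ε δ : Fin 3) (i j : ℕ) : Commute (wittY p ε i) (wittY p δ j) :=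
  commute_ncAeval_ncAeval fun _ _ _ _ => commute_ghostY _ _ _ _

lemma commute_wittY_wittX {ε δ : Fin 3} (h : ε ≠ δ) (i j : ℕ) :
    Commute (wittY p ε j) (wittX p δ i) :=
  commute_ncAeval_ncAeval fun _ _ _ _ => commute_ghostY_ghostX h _ _

/-- The universal Witt vectors. -/
def univWitt (ε : Fin 3) : WittVector p WittRing := WittVector.mk p fun i => X (ε, i)

lemma ghostComponent_univWitt (ε : Fin 3) (k : ℕ) :
    WittVector.ghostComponent k (WittVector.map (toGhostRing p) (univWitt p ε)) = X (ε, ppow p k) := by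
  have h := congrArg (rename (R := ℚ) fun k => (ε, ppow p k)) (bind₁_xInTermsOfW_wittPolynomial p ℚ k)
  rw [rename_X] at h
  rw [← h, WittVector.ghostComponent_apply, rename_bind₁, bind₁, ← map_wittPolynomial p (algebraMap ℤ ℚ) k,
    aeval_map_algebraMap]
  congr 2
  funext i
  simp [univWitt, WittVector.map_coeff, toGhostRing_X]

lemma wittY_one (ε : Fin 3) (j : ℕ) :
    wittY p ε j 1 = toGhostRing p ((univWitt p (ε + 1) * univWitt p (ε + 2)).coeff j) := by
  have h (q : MvPolynomial ℕ ℚ) :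
      ncAeval (ghostY ε ∘ ppow p) (fun _ _ => commute_ghostY _ _ _ _) q 1 =
        aeval (fun k => WittVector.ghostComponent k (WittVector.map (toGhostRing p)
          (univWitt p (ε + 1) * univWitt p (ε + 2)))) q := by
    have h1 : ε + 1 ≠ ε := by fin_cases ε <;> decide
    have h2 : ε + 2 ≠ ε := by fin_cases ε <;> decide
    induction q using MvPolynomial.induction_on with
    | C a => simp [← algebraMap_eq, Algebra.algebraMap_eq_smul_one]
    | add q r hq hr => simp [hq, hr]
    | mul_X q k hq =>
      have hcomm {δ : Fin 3} (hδ : δ ≠ ε) : Commute (ghostX δ (ppow p k)) (ncAeval (ghostY ε ∘ ppow p)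
          (fun _ _ => commute_ghostY _ _ _ _) q) :=
        commute_ncAeval fun _ _ => (commute_ghostY_ghostX hδ.symm _ _).symm
      have hY : ghostY ε (ppow p k) 1 = (ghostX (ε + 1) (ppow p k) * ghostX (ε + 2) (ppow p k)) 1 := by
        simp [ghostY_apply, ghostX_apply]
      rw [map_mul, map_mul, ncAeval_X, aeval_X, ← hq, Module.End.mul_apply, Function.comp_apply, hY,
        ← Module.End.mul_apply, ← ((hcomm h1).mul_left (hcomm h2)).eq, map_mul, map_mul,
        ghostComponent_univWitt, ghostComponent_univWitt, mul_comm]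
      simp [ghostX_apply, mul_assoc]
  rw [wittY, wittOfGhost, h, WittVector.bind₁_xInTermsOfW_ghost, WittVector.map_coeff]

/-- The lattice spanned by the monomials in the Witt components. -/
def wittLattice : Subalgebra ℤ GhostRing :=
  Algebra.adjoin ℤ (Set.range fun v => toGhostRing p (X v))

lemma toGhostRing_mem (f : WittRing) : toGhostRing p f ∈ wittLattice p := by
  induction f using MvPolynomial.induction_on with
  | C a => simp
  | add f g hf hg => rw [map_add]; exact add_mem hf hg
  | mul_X f v hf => rw [map_mul]; exact mul_mem hf (Algebra.subset_adjoin ⟨v, rfl⟩)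

lemma wittLattice_eq : (toGhostRing p).toIntAlgHom.range = wittLattice p := by
  refine le_antisymm ?_ (Algebra.adjoin_le ?_)
  · rintro _ ⟨f, rfl⟩
    exact toGhostRing_mem p f
  · rintro _ ⟨v, rfl⟩
    exact ⟨X v, rfl⟩

/-- The operators preserving the lattice. -/
def latticeOps : Subring (Module.End ℚ GhostRing) :=
  (Subalgebra.toSubmodule (wittLattice p)).preserving.toSubring.comap
    (Module.toModuleEnd ℤ (S := Module.End ℚ GhostRing) GhostRing)

variable {p} in
lemma mem_latticeOps {T : Module.End ℚ GhostRing} :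
    T ∈ latticeOps p ↔ ∀ f ∈ wittLattice p, T f ∈ wittLattice p := Iff.rfl

lemma wittX_mem (ε : Fin 3) (i : ℕ) : wittX p ε i ∈ latticeOps p := by
  refine mem_latticeOps.2 fun f hf => ?_
  rw [wittX_eq]
  exact mul_mem (toGhostRing_mem p _) hf

/-- The lattice is a copy of the integral polynomial ring. -/
def latticeEquiv : WittRing ≃ₗ[ℤ] Subalgebra.toSubmodule (wittLattice p) :=
  (AlgEquiv.ofInjective (toGhostRing p).toIntAlgHom (toGhostRing_injective p)).toLinearEquiv.trans
    (LinearEquiv.ofEq _ _ (congrArg Subalgebra.toSubmodule (wittLattice_eq p)))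

/-- The action of the operators preserving the lattice on the integral polynomial ring. -/
def latticeAction : latticeOps p →+* Module.End ℤ WittRing :=
  ((latticeEquiv p).symm.conjRingEquiv.toRingHom.comp
    (Subalgebra.toSubmodule (wittLattice p)).restrictPreserving.toRingHom).comp
    ((Module.toModuleEnd ℤ (S := Module.End ℚ GhostRing) GhostRing).restrict _ _ fun _ h => h)

lemma toGhostRing_latticeAction (T : latticeOps p) (f : WittRing) :
    toGhostRing p (latticeAction p T f) = T.1 (toGhostRing p f) :=
  congrArg Subtype.val ((latticeEquiv p).apply_symm_apply _)

lemma wittY_mul_wittX {c : ℕ+ → ℕ+ → MvPolynomial (ℕ+ ⊕ₗ ℕ+) ℤ} (hc : IsCFamily c)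
    (ε : Fin 3) (i j : ℕ) : WittCommRel p c (wittX p ε) (wittY p ε) i j := by
  have h := lie_wittOfGhost p hc (commute_ghostX ε ε) (commute_ghostY ε ε)
    (ghostY_mul_ghostX ε) i j
  exact sub_eq_iff_eq_add'.1 h

lemma wittY_mem {c : ℕ+ → ℕ+ → MvPolynomial (ℕ+ ⊕ₗ ℕ+) ℤ} (hc : IsCFamily c) (ε : Fin 3) (j : ℕ) :
    wittY p ε j ∈ latticeOps p := by
  have hX (v : Fin 3 × ℕ) : Algebra.lmul ℤ GhostRing (toGhostRing p (X v)) =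
      Module.toModuleEnd ℤ (S := Module.End ℚ GhostRing) GhostRing (wittX p v.1 v.2) := by
    rw [wittX_eq]
    rfl
  refine hc.mem_preserving_adjoin (p := p) isLowerSet_univ isLowerSet_univ
    (x := fun i => toGhostRing p (X (ε, i)))
    (Y := fun j => Module.toModuleEnd ℤ (S := Module.End ℚ GhostRing) GhostRing (wittY p ε j))
    (fun i _ j _ => ?_) (s := Set.range fun v => toGhostRing p (X v))
    (fun i _ => ⟨(ε, i), rfl⟩) ?_ (fun j _ => ?_) (Set.mem_univ j)
  · simp only [hX]
    exact (wittY_mul_wittX p hc ε i j).map _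
  · rintro _ ⟨⟨δ, i⟩, rfl⟩
    by_cases h : δ = ε
    · exact .inl ⟨i, trivial, by rw [h]⟩
    · refine .inr fun j _ => ?_
      rw [hX]
      exact (commute_wittY_wittX p (Ne.symm h) i j).map _
  · change wittY p ε j 1 ∈ wittLattice p
    rw [wittY_one]
    exact toGhostRing_mem p _

variable {p} {c : ℕ+ → ℕ+ → MvPolynomial (ℕ+ ⊕ₗ ℕ+) ℤ}

lemma commute_ghostY_ppow (ε : Fin 3) (k l : ℕ) (h : k ≠ l) :
    Commute ((ghostY ε ∘ ppow p) l) ((ghostX ε ∘ ppow p) k) := by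
  simp only [Function.comp_apply]
  rw [commute_iff_eq, ghostY_mul_ghostX, if_neg fun h' => h (ppow_injective p h'), add_zero]

lemma wittY_mul_wittX_pow (hc : IsCFamily c) (ε : Fin 3) {j s : ℕ} (h : j < s) (r : ℕ) :
    ∃ t ∈ latticeOps p, wittY p ε j * wittX p ε r ^ p ^ s =
      wittX p ε r ^ p ^ s * wittY p ε j + p * t := by
  obtain ⟨t, ht, h'⟩ := lie_wittOfGhost_pow p (latticeOps p) (wittX_mem p ε) (wittY_mem p hc ε)
    (commute_ghostY_ppow ε) h r
  exact ⟨t, ht, sub_eq_iff_eq_add'.1 h'⟩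

lemma wittY_pow_mul_wittX (hc : IsCFamily c) (ε : Fin 3) {r i : ℕ} (h : r < i) (j : ℕ) :
    ∃ t ∈ latticeOps p, wittY p ε j ^ p ^ i * wittX p ε r =
      wittX p ε r * wittY p ε j ^ p ^ i + p * t := by
  obtain ⟨t, ht, h'⟩ := lie_pow_wittOfGhost p (latticeOps p) (wittX_mem p ε) (wittY_mem p hc ε)
    (commute_ghostY_ppow ε) h j
  exact ⟨t, ht, sub_eq_iff_eq_add'.1 h'⟩

lemma wittY_pow_mul_wittX_pow (hc : IsCFamily c) (ε : Fin 3) (i j : ℕ) :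
    ∃ t ∈ latticeOps p, wittY p ε j ^ p ^ i * wittX p ε i ^ p ^ j =
      wittX p ε i ^ p ^ j * wittY p ε j ^ p ^ i + (1 + p * t) := by
  have hp : IsUnit (p : Module.End ℚ GhostRing) := by
    have : IsUnit (p : ℚ) := by simp [(Fact.out : p.Prime).ne_zero]
    rw [← map_natCast (algebraMap ℚ (Module.End ℚ GhostRing))]
    exact this.map _
  have hcomm (k l : ℕ) : (ghostY ε ∘ ppow p) l * (ghostX ε ∘ ppow p) k =
      (ghostX ε ∘ ppow p) k * (ghostY ε ∘ ppow p) l +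
        if k = l then (p : Module.End ℚ GhostRing) ^ k else 0 := by
    simp only [Function.comp_apply]
    rw [ghostY_mul_ghostX, coe_ppow, Nat.cast_pow]
    simp only [(ppow_injective p).eq_iff]
  obtain ⟨t, ht, h'⟩ := lie_pow_wittOfGhost_pow p (latticeOps p) (wittX_mem p ε) (wittY_mem p hc ε)
    hcomm hp i j
  exact ⟨t, ht, sub_eq_iff_eq_add'.1 h'⟩

end TripleLattice

open TripleLattice in
/-- Three families of operators on the integral polynomial ring in three families of variables,
satisfying the universal commutation relations. -/
theorem IsCFamily.exists_integral_operators (p : ℕ) [Fact p.Prime]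
    {c : ℕ+ → ℕ+ → MvPolynomial (ℕ+ ⊕ₗ ℕ+) ℤ} (hc : IsCFamily c) :
    ∃ y : Fin 3 → ℕ → Module.End ℤ WittRing,
      (∀ ε i j, WittCommRel p c (fun i => Algebra.lmul ℤ WittRing (X (ε, i))) (y ε) i j) ∧
      (∀ ε δ i j, Commute (y ε i) (y δ j)) ∧
      (∀ ε δ i j, ε ≠ δ → Commute (y ε j) (Algebra.lmul ℤ WittRing (X (δ, i)))) ∧
      (∀ ε j, y ε j 1 = (univWitt p (ε + 1) * univWitt p (ε + 2)).coeff j) ∧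
      (∀ ε j s r, j < s → ∃ t, y ε j * Algebra.lmul ℤ WittRing (X (ε, r)) ^ p ^ s =
        Algebra.lmul ℤ WittRing (X (ε, r)) ^ p ^ s * y ε j + p * t) ∧
      (∀ ε r i j, r < i → ∃ t, y ε j ^ p ^ i * Algebra.lmul ℤ WittRing (X (ε, r)) =
        Algebra.lmul ℤ WittRing (X (ε, r)) * y ε j ^ p ^ i + p * t) ∧
      ∀ ε i j, ∃ t, y ε j ^ p ^ i * Algebra.lmul ℤ WittRing (X (ε, i)) ^ p ^ j =
        Algebra.lmul ℤ WittRing (X (ε, i)) ^ p ^ j * y ε j ^ p ^ i + (1 + p * t) := by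
  let x' (ε : Fin 3) (i : ℕ) : latticeOps p := ⟨wittX p ε i, wittX_mem p ε i⟩
  let y' (ε : Fin 3) (j : ℕ) : latticeOps p := ⟨wittY p ε j, wittY_mem p hc ε j⟩
  have hx' (ε i) : latticeAction p (x' ε i) = Algebra.lmul ℤ WittRing (X (ε, i)) := by
    refine LinearMap.ext fun f => toGhostRing_injective p ?_
    rw [toGhostRing_latticeAction]
    simp [x', wittX_eq]
  have hval {a b : latticeOps p} (h : a.1 = b.1) : latticeAction p a = latticeAction p b :=
    congrArg _ (Subtype.ext h)
  simp only [← hx']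
  refine ⟨fun ε j => latticeAction p (y' ε j), fun ε i j => ?_, fun ε δ i j => ?_,
    fun ε δ i j h => ?_, fun ε j => ?_, fun ε j s r h => ?_, fun ε r i j h => ?_, fun ε i j => ?_⟩
  · exact (WittCommRel.of_map (f := (latticeOps p).subtype) Subtype.val_injective
      (wittY_mul_wittX p hc ε i j)).map _
  · exact (show Commute (y' ε i) (y' δ j) from Subtype.ext (commute_wittY p ε δ i j)).map _
  · exact (show Commute (y' ε j) (x' δ i) from Subtype.ext (commute_wittY_wittX p h i j)).map _
  · refine toGhostRing_injective p ?_
    rw [toGhostRing_latticeAction, map_one, ← wittY_one]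
  · obtain ⟨t, ht, h'⟩ := wittY_mul_wittX_pow (p := p) hc ε h r
    refine ⟨latticeAction p ⟨t, ht⟩, ?_⟩
    simpa using hval (a := y' ε j * x' ε r ^ p ^ s) (b := x' ε r ^ p ^ s * y' ε j + p * ⟨t, ht⟩)
      (by simpa using h')
  · obtain ⟨t, ht, h'⟩ := wittY_pow_mul_wittX (p := p) hc ε h j
    refine ⟨latticeAction p ⟨t, ht⟩, ?_⟩
    simpa using hval (a := y' ε j ^ p ^ i * x' ε r) (b := x' ε r * y' ε j ^ p ^ i + p * ⟨t, ht⟩)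
      (by simpa using h')
  · obtain ⟨t, ht, h'⟩ := wittY_pow_mul_wittX_pow (p := p) hc ε i j
    refine ⟨latticeAction p ⟨t, ht⟩, ?_⟩
    simpa using hval (a := y' ε j ^ p ^ i * x' ε i ^ p ^ j)
      (b := x' ε i ^ p ^ j * y' ε j ^ p ^ i + (1 + p * ⟨t, ht⟩)) (by simpa using h')

end IntegralModel

section TripleOperators

/-- Three commuting families of operators on a commutative algebra, each of which satisfies the
commutation relations of the truncated `p`-typical algebra with a family of multiplication
operators. -/
structure IsTripleOperators {K B : Type*} [CommRing K] [CommRing B] [Algebra K B] (p : ℕ)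
    (c : ℕ+ → ℕ+ → MvPolynomial (ℕ+ ⊕ₗ ℕ+) ℤ) (n : ℕ) (x : Fin 3 → ℕ → B)
    (Y : Fin 3 → ℕ → Module.End K B) : Prop where
  rel : ∀ ε, ∀ i < n, ∀ j < n, WittCommRel p c (fun i => Algebra.lmul K B (x ε i)) (Y ε) i j
  commute : ∀ ε δ, ∀ i < n, ∀ j < n, Commute (Y ε i) (Y δ j)
  commute_lmul : ∀ ε δ, ε ≠ δ → ∀ i < n, ∀ j < n, Commute (Y ε j) (Algebra.lmul K B (x δ i))
  commute_lmul_one : ∀ ε, ∀ j < n, Commute (Y ε j) (Algebra.lmul K B (Y ε j 1))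
  commute_lmul_pow : ∀ ε, ∀ r < n, ∀ j < n, ∀ s, j < s →
    Commute (Y ε j) (Algebra.lmul K B (x ε r) ^ p ^ s)
  commute_pow_lmul : ∀ ε, ∀ r < n, ∀ j < n, ∀ i, r < i →
    Commute (Y ε j ^ p ^ i) (Algebra.lmul K B (x ε r))
  pow_mul_pow : ∀ ε, ∀ i < n, ∀ j < n, Y ε j ^ p ^ i * Algebra.lmul K B (x ε i) ^ p ^ j =
    Algebra.lmul K B (x ε i) ^ p ^ j * Y ε j ^ p ^ i + 1

namespace IsTripleOperators

variable {K B B' : Type*} [CommRing K] [CommRing B] [Algebra K B] [CommRing B'] [Algebra K B']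
  {p : ℕ} {c : ℕ+ → ℕ+ → MvPolynomial (ℕ+ ⊕ₗ ℕ+) ℤ} {n : ℕ} {x : Fin 3 → ℕ → B}
  {Y : Fin 3 → ℕ → Module.End K B}

lemma pow_apply_one (h : IsTripleOperators p c n x Y) (ε : Fin 3) {j : ℕ} (hj : j < n) (k : ℕ) :
    (Y ε j ^ k) 1 = Y ε j 1 ^ k := by
  induction k with
  | zero => simp
  | succ k ih =>
    have := congrArg (fun T => T 1) ((h.commute_lmul_one ε j hj).pow_left k).eq
    simp only [Module.End.mul_apply, Algebra.coe_lmul_eq_mul, LinearMap.mul_apply_apply, mul_one] at this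
    rw [pow_succ, Module.End.mul_apply, this, ih, pow_succ']

lemma transfer [Fact p.Prime] (hc : IsCFamily c) (h : IsTripleOperators p c n x Y)
    {x' : Fin 3 → ℕ → B'} {Y' : Fin 3 → ℕ → Module.End K B'}
    {Q : Subring (Module.End K B × Module.End K B')} (hQ : ∀ q ∈ Q, q.1 = 0 → q.2 = 0)
    (hx : ∀ ε, ∀ i < n, (Algebra.lmul K B (x ε i), Algebra.lmul K B' (x' ε i)) ∈ Q)
    (hY : ∀ ε, ∀ j < n, (Y ε j, Y' ε j) ∈ Q)
    (hY1 : ∀ ε, ∀ j < n, (Algebra.lmul K B (Y ε j 1), Algebra.lmul K B' (Y' ε j 1)) ∈ Q) :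
    IsTripleOperators p c n x' Y' := by
  have heq {a b : Module.End K B × Module.End K B'} (ha : a ∈ Q) (hb : b ∈ Q) (hab : a.1 = b.1) :
      a.2 = b.2 :=
    sub_eq_zero.1 (hQ _ (Q.sub_mem ha hb) (sub_eq_zero.2 hab))
  have hcomm {a b : Module.End K B × Module.End K B'} (ha : a ∈ Q) (hb : b ∈ Q)
      (hab : Commute a.1 b.1) : Commute a.2 b.2 :=
    heq (Q.mul_mem ha hb) (Q.mul_mem hb ha) hab
  refine ⟨fun ε i hi j hj => ?_, fun ε δ i hi j hj => hcomm (hY ε i hi) (hY δ j hj) (h.commute ε δ i hi j hj),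
    fun ε δ hεδ i hi j hj => hcomm (hY ε j hj) (hx δ i hi) (h.commute_lmul ε δ hεδ i hi j hj),
    fun ε j hj => hcomm (hY ε j hj) (hY1 ε j hj) (h.commute_lmul_one ε j hj),
    fun ε r hr j hj s hs => hcomm (hY ε j hj) (Q.pow_mem (hx ε r hr) _) (h.commute_lmul_pow ε r hr j hj s hs),
    fun ε r hr j hj i hi => hcomm (Q.pow_mem (hY ε j hj) _) (hx ε r hr) (h.commute_pow_lmul ε r hr j hj i hi),
    fun ε i hi j hj => heq (Q.mul_mem (Q.pow_mem (hY ε j hj) (p ^ i)) (Q.pow_mem (hx ε i hi) (p ^ j)))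
      (Q.add_mem (Q.mul_mem (Q.pow_mem (hx ε i hi) (p ^ j)) (Q.pow_mem (hY ε j hj) (p ^ i))) Q.one_mem)
      (h.pow_mul_pow ε i hi j hj)⟩
  have hcQ : cEval (fun d => (Algebra.lmul K B (x ε (padicValNat p d)), Algebra.lmul K B' (x' ε (padicValNat p d))))
      (fun e => (Y ε (padicValNat p e), Y' ε (padicValNat p e))) (c (ppow p i) (ppow p j)) ∈ Q := by
    refine hc.cEval_ppow_mem p Q ?_ ?_ <;> intro r hr <;> rw [padicValNat_ppow]
    exacts [hx ε r (hr.trans hi), hY ε r (hr.trans hj)]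
  have h1 := map_cEval (RingHom.fst (Module.End K B) (Module.End K B'))
    (fun d => (Algebra.lmul K B (x ε (padicValNat p d)), Algebra.lmul K B' (x' ε (padicValNat p d))))
    (fun e => (Y ε (padicValNat p e), Y' ε (padicValNat p e))) (c (ppow p i) (ppow p j))
  have h2 := map_cEval (RingHom.snd (Module.End K B) (Module.End K B'))
    (fun d => (Algebra.lmul K B (x ε (padicValNat p d)), Algebra.lmul K B' (x' ε (padicValNat p d))))
    (fun e => (Y ε (padicValNat p e), Y' ε (padicValNat p e))) (c (ppow p i) (ppow p j))
  have := heq (Q.mul_mem (hY ε j hj) (hx ε i hi))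
    (Q.add_mem (Q.mul_mem (hx ε i hi) (hY ε j hj)) hcQ)
    ((h.rel ε i hi j hj).trans (congrArg _ h1.symm))
  exact this.trans (congrArg (Algebra.lmul K B' (x' ε i) * Y' ε j + ·) h2)

lemma quotient [Fact p.Prime] (hc : IsCFamily c) (h : IsTripleOperators p c n x Y) (I : Ideal B)
    (hI : ∀ ε, ∀ j < n, ∀ f ∈ I, Y ε j f ∈ I) :
    ∃ Y' : Fin 3 → ℕ → Module.End K (B ⧸ I),
      (∀ ε, ∀ j < n, ∀ f, Y' ε j (Ideal.Quotient.mk I f) = Ideal.Quotient.mk I (Y ε j f)) ∧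
      IsTripleOperators p c n (fun ε i => Ideal.Quotient.mk I (x ε i)) Y' := by
  let Y' (ε : Fin 3) (j : ℕ) : Module.End K (B ⧸ I) :=
    if hj : j < n then
      (I.restrictScalars K).mapQ (I.restrictScalars K) (Y ε j) fun f hf => hI ε j hj f hf
    else 0
  have hY' (ε j) (hj : j < n) (f : B) :
      Y' ε j (Ideal.Quotient.mk I f) = Ideal.Quotient.mk I (Y ε j f) := by
    have : Y' ε j = _ := dif_pos hj
    rw [this]
    rfl
  let Q : Subring (Module.End K B × Module.End K (B ⧸ I)) :=
    { carrier := {q | ∀ f, q.2 (Ideal.Quotient.mk I f) = Ideal.Quotient.mk I (q.1 f)}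
      mul_mem' := fun {a b} ha hb f => by simp [hb f, ha (b.1 f)]
      one_mem' := fun f => rfl
      add_mem' := fun {a b} ha hb f => by simp [hb f, ha f]
      zero_mem' := fun f => by simp
      neg_mem' := fun {a} ha f => by simp [ha f] }
  refine ⟨Y', hY', h.transfer hc (Q := Q) ?_ ?_ hY' ?_⟩
  · intro q hq hq1
    refine LinearMap.ext fun f => ?_
    obtain ⟨f, rfl⟩ := Ideal.Quotient.mk_surjective f
    rw [hq f, hq1]
    simp
  · intro ε i _ f
    simp
  · intro ε j hj f
    have := hY' ε j hj 1
    rw [map_one] at this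
    simp [this]

lemma restrict [Fact p.Prime] (hc : IsCFamily c) (h : IsTripleOperators p c n x Y)
    (S : Subalgebra K B) (hx : ∀ ε, ∀ i < n, x ε i ∈ S) (hS : ∀ ε, ∀ j < n, ∀ f ∈ S, Y ε j f ∈ S) :
    ∃ (x' : Fin 3 → ℕ → S) (Y' : Fin 3 → ℕ → Module.End K S),
      (∀ ε, ∀ i < n, (x' ε i : B) = x ε i) ∧
      (∀ ε, ∀ j < n, ∀ f, (Y' ε j f : B) = Y ε j f) ∧ IsTripleOperators p c n x' Y' := by
  let x' (ε : Fin 3) (i : ℕ) : S := if hi : i < n then ⟨x ε i, hx ε i hi⟩ else 0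
  let Y' (ε : Fin 3) (j : ℕ) : Module.End K S :=
    if hj : j < n then (Y ε j).restrict (p := Subalgebra.toSubmodule S) (q := Subalgebra.toSubmodule S) (hS ε j hj) else 0
  have hx' (ε i) (hi : i < n) : (x' ε i : B) = x ε i := by simp [x', hi]
  have hY' (ε j) (hj : j < n) (f : S) : (Y' ε j f : B) = Y ε j f := by
    have : Y' ε j = _ := dif_pos hj
    rw [this]
    rfl
  let Q : Subring (Module.End K B × Module.End K S) :=
    { carrier := {q | ∀ f : S, (q.2 f : B) = q.1 f}
      mul_mem' := fun {a b} ha hb f => by simp [← hb f, ha (b.2 f)]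
      one_mem' := fun f => rfl
      add_mem' := fun {a b} ha hb f => by simp [hb f, ha f]
      zero_mem' := fun f => by simp
      neg_mem' := fun {a} ha f => by simp [ha f] }
  refine ⟨x', Y', hx', hY', h.transfer hc (Q := Q) ?_ ?_ hY' ?_⟩
  · intro q hq hq1
    refine LinearMap.ext fun f => Subtype.ext ?_
    rw [hq f, hq1]
    simp
  · intro ε i hi f
    simp [hx' ε i hi]
  · intro ε j hj f
    simp [hY' ε j hj 1]

end IsTripleOperators

open TripleLattice MvPolynomial
open scoped TensorProduct

lemma WittVector.coeff_mul_pow_char_pow {p : ℕ} [hp : Fact p.Prime] {B : Type*} [CommRing B] [CharP B p]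
    (u v : WittVector p B) (n j : ℕ) :
    (u * v).coeff j ^ p ^ n =
      (WittVector.mk p (fun i => u.coeff i ^ p ^ n) * WittVector.mk p fun i => v.coeff i ^ p ^ n).coeff j := by
  have h (w : WittVector p B) : WittVector.map (iterateFrobenius B p n) w =
      WittVector.mk p fun i => w.coeff i ^ p ^ n := by
    ext i
    simp [WittVector.map_coeff, iterateFrobenius_def]
  rw [← h, ← h, ← map_mul, WittVector.map_coeff, iterateFrobenius_def]

theorem IsCFamily.exists_tripleOperators_tensor {p : ℕ} [Fact p.Prime]
    {c : ℕ+ → ℕ+ → MvPolynomial (ℕ+ ⊕ₗ ℕ+) ℤ} (hc : IsCFamily c) (K : Type*) [Field K] [CharP K p] :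
    ∃ Y : Fin 3 → ℕ → Module.End K (K ⊗[ℤ] WittRing),
      (∀ n, IsTripleOperators p c n (fun ε i => (1 : K) ⊗ₜ[ℤ] (X (ε, i) : WittRing)) Y) ∧
      ∀ ε j, Y ε j 1 = (1 : K) ⊗ₜ (univWitt p (ε + 1) * univWitt p (ε + 2)).coeff j := by
  obtain ⟨y, h1, h2, h3, h4, h5, h6, h7⟩ := hc.exists_integral_operators p
  let ρ := Module.End.baseChangeHom ℤ K WittRing
  have hρ (f : WittRing) : ρ (Algebra.lmul ℤ WittRing f) = Algebra.lmul K (K ⊗[ℤ] WittRing) (1 ⊗ₜ f) := by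
    refine LinearMap.ext fun z => ?_
    induction z with
    | zero => simp
    | add z w hz hw => rw [map_add, map_add, hz, hw]
    | tmul k g =>
      trans k ⊗ₜ[ℤ] (f * g)
      · rfl
      · simp
  have hp (t : Module.End ℤ WittRing) : ρ (p * t) = 0 := by
    have : (p : Module.End K (K ⊗[ℤ] WittRing)) = 0 := by
      rw [← map_natCast (algebraMap K _), CharP.cast_eq_zero, map_zero]
    rw [map_mul, map_natCast, this, zero_mul]
  have hone (ε j) : ρ (y ε j) 1 = (1 : K) ⊗ₜ (univWitt p (ε + 1) * univWitt p (ε + 2)).coeff j := by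
    rw [← h4]
    rfl
  refine ⟨fun ε j => ρ (y ε j), fun n => ⟨fun ε i _ j _ => ?_, fun ε δ i _ j _ => (h2 ε δ i j).map ρ,
    fun ε δ hεδ i _ j _ => ?_, fun ε j _ => ?_, fun ε r _ j _ s hs => ?_, fun ε r _ j _ i hi => ?_,
    fun ε i _ j _ => ?_⟩, hone⟩
  · simp only [← hρ]
    exact (h1 ε i j).map (B := Module.End K (K ⊗[ℤ] WittRing)) (ρ : Module.End ℤ WittRing →+* _)
  · rw [← hρ]
    exact (h3 ε δ i j hεδ).map ρ
  · rw [hone, ← hρ]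
    refine Commute.map ?_ ρ
    let S : Subring WittRing :=
      (Subring.centralizer {y ε j}).comap (Algebra.lmul ℤ WittRing : WittRing →+* Module.End ℤ WittRing)
    have hS (f : WittRing) : f ∈ S ↔ Commute (y ε j) (Algebra.lmul ℤ WittRing f) := by
      simp [S, Subring.mem_centralizer_iff, Commute, SemiconjBy]
    rw [← hS]
    refine WittVector.coeff_mul_mem S (fun i => ?_) (fun i => ?_) j <;>
      rw [hS] <;> refine h3 ε _ i j ?_ <;> fin_cases ε <;> decide
  · obtain ⟨t, ht⟩ := h5 ε j s r hs
    have := congrArg ρ ht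
    rwa [map_add, hp, add_zero, map_mul, map_mul, map_pow, hρ] at this
  · obtain ⟨t, ht⟩ := h6 ε r i j hi
    have := congrArg ρ ht
    rwa [map_add, hp, add_zero, map_mul, map_mul, map_pow, hρ] at this
  · obtain ⟨t, ht⟩ := h7 ε i j
    have := congrArg ρ ht
    rwa [map_add, map_add, hp, add_zero, map_one, map_mul, map_mul, map_pow, map_pow, hρ] at this

end TripleOperators

section TripleModel
open TripleLattice MvPolynomial
open scoped TensorProduct

lemma WittVector.coeff_mul_congr {p : ℕ} [Fact p.Prime] {B : Type*} [CommRing B] {n : ℕ}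
    {u v u' v' : WittVector p B} (hu : ∀ i < n, u.coeff i = u'.coeff i)
    (hv : ∀ i < n, v.coeff i = v'.coeff i) {j : ℕ} (hj : j < n) :
    (u * v).coeff j = (u' * v').coeff j := by
  have h {w w' : WittVector p B} (h : ∀ i < n, w.coeff i = w'.coeff i) :
      WittVector.truncate n w = WittVector.truncate n w' := by
    ext i
    rw [WittVector.coeff_truncate, WittVector.coeff_truncate, h i i.2]
  have := congrArg (fun w => TruncatedWittVector.coeff ⟨j, hj⟩ w)
    (congrArg₂ (· * ·) (h hu) (h hv))
  simpa only [← map_mul, WittVector.coeff_truncate] using this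

lemma End.eq_algebraMap_of_commute {K R : Type*} [CommRing K] [CommRing R] [Algebra K R] {s : Set R}
    (hs : Algebra.adjoin K s = ⊤) {T : Module.End K R} (hT : ∀ r ∈ s, Commute T (Algebra.lmul K R r)) {k : K}
    (h1 : T 1 = algebraMap K R k) : T = algebraMap K (Module.End K R) k := by
  let C : Subalgebra K R := (Subalgebra.centralizer K {T}).comap (Algebra.lmul K R)
  have hC : C = ⊤ := by
    rw [eq_top_iff, ← hs, Algebra.adjoin_le_iff]
    rintro r hr _ rfl
    exact (hT r hr).eq
  refine LinearMap.ext fun r => ?_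
  have hr : r ∈ C := hC ▸ Algebra.mem_top
  simp only [C, Subalgebra.mem_comap, Subalgebra.mem_centralizer_iff, Set.mem_singleton_iff,
    forall_eq] at hr
  have := congrArg (fun T => T 1) hr
  simpa [h1, Algebra.smul_def, mul_comm] using this

variable {p : ℕ} [Fact p.Prime] {c : ℕ+ → ℕ+ → MvPolynomial (ℕ+ ⊕ₗ ℕ+) ℤ} {K : Type*} [Field K]
  [CharP K p]

lemma IsTripleOperators.exists_specialization (hc : IsCFamily c) {M : Type*} [CommRing M]
    [Algebra K M] {ξ : Fin 3 → ℕ → M} {Y₀ : Fin 3 → ℕ → Module.End K M}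
    (h₀ : ∀ n, IsTripleOperators p c n ξ Y₀)
    (hone : ∀ ε j, Y₀ ε j 1 =
      (WittVector.mk p (ξ (ε + 1)) * WittVector.mk p (ξ (ε + 2))).coeff j)
    (n : ℕ) (A : Fin 3 → WittVector p K) {L : Type*} [Field L] [Algebra K L] (φ : M →ₐ[K] L)
    (hφ : ∀ ε i, φ (ξ ε i) ^ p ^ n = algebraMap K L ((A ε).coeff i)) :
    ∃ (I : Ideal M) (S : Subalgebra K (M ⧸ I)) (x : Fin 3 → ℕ → S) (Y : Fin 3 → ℕ → Module.End K S),
      Nontrivial S ∧ IsTripleOperators p c n x Y ∧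
      (∀ ε, ∀ i < n, x ε i ^ p ^ n = algebraMap K S ((A ε).coeff i)) ∧
      (∀ ε, ∀ j < n, Y ε j ^ p ^ n =
        algebraMap K (Module.End K S) ((A (ε + 1) * A (ε + 2)).coeff j)) ∧
      Algebra.adjoin K {r | ∃ ε, ∃ i < n, x ε i = r} = ⊤ := by
  let g (v : Fin 3 × ℕ) : M := ξ v.1 v.2 ^ p ^ n - algebraMap K M ((A v.1).coeff v.2)
  let I : Ideal M := Ideal.span (Set.range g)
  have hI : I ≠ ⊤ := by
    have hφ : I ≤ RingHom.ker φ := by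
      rw [Ideal.span_le]
      rintro _ ⟨v, rfl⟩
      rw [SetLike.mem_coe, RingHom.mem_ker, map_sub, map_pow, hφ, AlgHom.commutes, sub_self]
    exact fun h => RingHom.ker_ne_top φ.toRingHom (top_le_iff.1 (h ▸ hφ))
  have hYI (ε) (j) (hj : j < n) (f) (hf : f ∈ I) : Y₀ ε j f ∈ I := by
    have hcomm (v) : Commute (Y₀ ε j) (Algebra.lmul K M (g v)) := by
      have hpow : Commute (Y₀ ε j) (Algebra.lmul K M (ξ v.1 v.2) ^ p ^ n) := by
        by_cases hv : ε = v.1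
        · rw [← hv]
          exact (h₀ (max (n + 1) (v.2 + 1))).commute_lmul_pow ε v.2 (by grind) j (by grind) n hj
        · exact ((h₀ (max (n + 1) (v.2 + 1))).commute_lmul ε v.1 hv v.2 (by grind) j
            (by grind)).pow_right _
      rw [map_sub, map_pow, AlgHom.commutes]
      exact hpow.sub_right (Algebra.commutes _ _).symm
    suffices ∀ a, Y₀ ε j (a * f) ∈ I by simpa using this 1
    induction hf using Submodule.span_induction with
    | zero => simp
    | add f f' _ _ hf hf' =>
      intro a
      rw [mul_add, map_add]
      exact I.add_mem (hf a) (hf' a)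
    | smul b f _ hf =>
      intro a
      rw [smul_eq_mul, ← mul_assoc]
      exact hf _
    | mem f hf =>
      obtain ⟨v, rfl⟩ := hf
      intro a
      have := congrArg (fun T => T a) (hcomm v).eq
      simp only [Module.End.mul_apply, Algebra.coe_lmul_eq_mul, LinearMap.mul_apply_apply] at this
      rw [mul_comm, this]
      exact I.mul_mem_right _ (Ideal.subset_span ⟨v, rfl⟩)
  have : Nontrivial (M ⧸ I) := Ideal.Quotient.nontrivial_iff.2 hI
  have : CharP (M ⧸ I) p := charP_of_injective_algebraMap (algebraMap K _).injective p
  obtain ⟨Y₁, hY₁, h₁⟩ := (h₀ n).quotient hc I hYI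
  let x₁ (ε : Fin 3) (i : ℕ) : M ⧸ I := Ideal.Quotient.mk I (ξ ε i)
  have hx₁ (ε i) : x₁ ε i ^ p ^ n = algebraMap K (M ⧸ I) ((A ε).coeff i) := by
    rw [← sub_eq_zero]
    exact Ideal.Quotient.eq_zero_iff_mem.2 (Ideal.subset_span (Set.mem_range_self (ε, i)))
  have hY₁one (ε) (j) (hj : j < n) : Y₁ ε j 1 =
      (WittVector.mk p (x₁ (ε + 1)) * WittVector.mk p (x₁ (ε + 2))).coeff j := by
    have hψ (δ) : WittVector.map (Ideal.Quotient.mk I) (WittVector.mk p (ξ δ)) =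
        WittVector.mk p (x₁ δ) := by
      ext i
      rw [WittVector.map_coeff]
      rfl
    rw [← hψ, ← hψ, ← map_mul, WittVector.map_coeff, ← map_one (Ideal.Quotient.mk I), hY₁ ε j hj,
      hone]
  let s : Set (M ⧸ I) := {r | ∃ ε, ∃ i < n, x₁ ε i = r}
  have hxs (ε i) (hi : i < n) : x₁ ε i ∈ s := ⟨ε, i, hi, rfl⟩
  have hYs (ε) (j) (hj : j < n) : Y₁ ε j 1 ∈ Algebra.adjoin K s := by
    let w (δ : Fin 3) : WittVector p (M ⧸ I) := WittVector.mk p fun i => if i < n then x₁ δ i else 0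
    rw [hY₁one ε j hj, WittVector.coeff_mul_congr (n := n) (u' := w (ε + 1)) (v' := w (ε + 2))
      (fun i hi => by simp [w, hi]) (fun i hi => by simp [w, hi]) hj]
    have hw (δ i) : (w δ).coeff i ∈ (Algebra.adjoin K s).toSubring := by
      by_cases hi : i < n
      · simpa [w, hi] using Algebra.subset_adjoin (hxs δ i hi)
      · simp [w, hi]
    exact WittVector.coeff_mul_mem _ (hw _) (hw _) j
  obtain ⟨x, Y, hx, hY, h⟩ := h₁.restrict hc (Algebra.adjoin K s)
    (fun ε i hi => Algebra.subset_adjoin (hxs ε i hi)) fun ε j hj => by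
      refine hc.mem_preserving_adjoin (isLowerSet_Iio n) (isLowerSet_Iio n) (x := x₁ ε) (Y := Y₁ ε)
        (fun i hi j hj => h₁.rel ε i hi j hj) (fun i hi => hxs ε i hi) ?_ (fun j hj => hYs ε j hj) hj
      rintro _ ⟨δ, i, hi, rfl⟩
      by_cases hδ : ε = δ
      · exact .inl ⟨i, hi, by rw [hδ]⟩
      · exact .inr fun j hj => h₁.commute_lmul ε δ hδ i hi j hj
  have hset : {r | ∃ ε, ∃ i < n, x ε i = r} = Subtype.val ⁻¹' s := by
    ext r
    refine exists_congr fun ε => exists_congr fun i => and_congr_right fun hi => ?_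
    rw [← Subtype.val_inj, hx ε i hi]
  have htop : Algebra.adjoin K {r | ∃ ε, ∃ i < n, x ε i = r} = ⊤ := by
    rw [hset]
    exact Algebra.adjoin_adjoin_coe_preimage
  refine ⟨I, _, x, Y, inferInstance, h, fun ε i hi => ?_, fun ε j hj => ?_, htop⟩
  · apply Subtype.ext
    rw [SubmonoidClass.coe_pow, hx ε i hi]
    exact hx₁ ε i
  · refine End.eq_algebraMap_of_commute htop ?_ ?_
    · rintro _ ⟨δ, i, hi, rfl⟩
      by_cases hδ : ε = δ
      · rw [← hδ]
        exact h.commute_pow_lmul ε i hi j hj n hi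
      · exact (h.commute_lmul ε δ hδ i hi j hj).pow_left _
    · rw [h.pow_apply_one ε hj]
      apply Subtype.ext
      rw [SubmonoidClass.coe_pow, hY ε j hj, OneMemClass.coe_one, hY₁one ε j hj,
        WittVector.coeff_mul_pow_char_pow]
      simp only [WittVector.coeff_mk, hx₁]
      have hA (δ) : WittVector.map (algebraMap K (M ⧸ I)) (A δ) =
          WittVector.mk p fun i => algebraMap K (M ⧸ I) ((A δ).coeff i) := by
        ext i
        rw [WittVector.map_coeff, WittVector.coeff_mk]
      rw [← hA, ← hA, ← map_mul, WittVector.map_coeff]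
      rfl

theorem IsCFamily.exists_tripleOperators.{u} {K : Type u} [Field K] [CharP K p] (hc : IsCFamily c)
    (n : ℕ) (A : Fin 3 → WittVector p K) :
    ∃ (R : Type u) (_ : CommRing R) (_ : Algebra K R)
      (x : Fin 3 → ℕ → R) (Y : Fin 3 → ℕ → Module.End K R), Nontrivial R ∧ IsTripleOperators p c n x Y ∧
      (∀ ε, ∀ i < n, x ε i ^ p ^ n = algebraMap K R ((A ε).coeff i)) ∧
      (∀ ε, ∀ j < n, Y ε j ^ p ^ n =
        algebraMap K (Module.End K R) ((A (ε + 1) * A (ε + 2)).coeff j)) ∧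
      Algebra.adjoin K {r | ∃ ε, ∃ i < n, x ε i = r} = ⊤ := by
  obtain ⟨Y₀, h₀, hY₀⟩ := hc.exists_tripleOperators_tensor K
  have hroot (v : Fin 3 × ℕ) :
      ∃ r : AlgebraicClosure K, r ^ p ^ n = algebraMap K _ ((A v.1).coeff v.2) :=
    IsAlgClosed.exists_pow_nat_eq _ (pow_pos (Fact.out : p.Prime).pos _)
  choose r hr using hroot
  let φ : K ⊗[ℤ] WittRing →ₐ[K] AlgebraicClosure K :=
    Algebra.TensorProduct.lift (Algebra.ofId K _) (aeval (R := ℤ) r) fun _ _ => Commute.all _ _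
  have hφ (v : Fin 3 × ℕ) : φ (1 ⊗ₜ X v) = r v :=
    (Algebra.TensorProduct.lift_tmul _ _ _ _ _).trans (by rw [map_one, one_mul, aeval_X])
  have hψ (δ) : WittVector.map (Algebra.TensorProduct.includeRight : WittRing →ₐ[ℤ] K ⊗[ℤ] WittRing)
      (univWitt p δ) = WittVector.mk p fun i => (1 : K) ⊗ₜ[ℤ] (X (δ, i) : WittRing) := by
    ext i
    rw [WittVector.map_coeff]
    rfl
  obtain ⟨I, S, x, Y, h⟩ := IsTripleOperators.exists_specialization hc h₀ (fun ε j => by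
    rw [hY₀, ← hψ, ← hψ, ← map_mul, WittVector.map_coeff]
    rfl) n A φ fun ε i => by rw [hφ, hr]
  exact ⟨S, inferInstance, inferInstance, x, Y, h⟩

end TripleModel

section TripleModel

theorem IsTripleOperators.finrank_and_eq_top {p : ℕ} [hp : Fact p.Prime]
    {c : ℕ+ → ℕ+ → MvPolynomial (ℕ+ ⊕ₗ ℕ+) ℤ} {K R : Type*} [Field K] [CharP K p] [CommRing R]
    [Algebra K R] [Nontrivial R] {n : ℕ} {x : Fin 3 → ℕ → R} {Y : Fin 3 → ℕ → Module.End K R}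
    (h : IsTripleOperators p c n x Y) {a : Fin 3 → ℕ → K}
    (hx : ∀ ε, ∀ i < n, x ε i ^ p ^ n = algebraMap K R (a ε i))
    (htop : Algebra.adjoin K {r | ∃ ε, ∃ i < n, x ε i = r} = ⊤) {S : Subalgebra K (Module.End K R)}
    (hxS : ∀ ε, ∀ i < n, Algebra.lmul K R (x ε i) ∈ S) (hYS : ∀ ε, ∀ j < n, Y ε j ∈ S) :
    FiniteDimensional K R ∧ Module.finrank K R = p ^ (n * (3 * n)) ∧ S = ⊤ := by
  have hS (r : R) : Algebra.lmul K R r ∈ S := by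
    have : S.comap (Algebra.lmul K R) = ⊤ := by
      rw [eq_top_iff, ← htop, Algebra.adjoin_le_iff]
      rintro _ ⟨ε, i, hi, rfl⟩
      exact hxS ε i hi
    exact (this ▸ Algebra.mem_top : r ∈ S.comap (Algebra.lmul K R))
  let ι := (Fin n)ᵒᵈ ×ₗ (Fin 3 ×ₗ Fin n)
  let mk (j : Fin n) (ε : Fin 3) (i : Fin n) : ι := toLex (OrderDual.toDual j, toLex (ε, i))
  have hmk (t : ι) : ∃ j ε i, t = mk j ε i := ⟨_, _, _, rfl⟩
  let J (t : ι) : Fin n := OrderDual.ofDual (ofLex t).1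
  let E (t : ι) : Fin 3 := (ofLex (ofLex t).2).1
  let I (t : ι) : Fin n := (ofLex (ofLex t).2).2
  let ξ (t : ι) : R := x (E t) (I t) ^ p ^ (J t : ℕ)
  let D (t : ι) : Module.End K R := Y (E t) (J t) ^ p ^ (I t : ℕ) -
    Algebra.lmul K R (Y (E t) (J t) 1 ^ p ^ (I t : ℕ))
  have hlt (j ε i j' ε' i') : mk j ε i < mk j' ε' i' ↔
      j' < j ∨ j = j' ∧ (ε < ε' ∨ ε = ε' ∧ i < i') := by
    simp only [mk, ι, Prod.Lex.toLex_lt_toLex, OrderDual.toDual_lt_toDual, EmbeddingLike.apply_eq_iff_eq]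
  have hξ (j ε i) : ξ (mk j ε i) = x ε i ^ p ^ (j : ℕ) := rfl
  have hcard : Fintype.card ι = n * (3 * n) := by
    simp [ι, Fintype.card_prod, Fintype.card_lex, Fintype.card_orderDual]
  have happ {T : Module.End K R} {r : R} (hT : Commute T (Algebra.lmul K R r)) (f : R) :
      T (r * f) = r * T f := congrArg (fun T => T f) hT.eq
  rw [← hcard]
  refine finrank_and_eq_top_of_operators p (x := ξ) (D := D) hS (fun t => ?_) (fun t => ?_)
    (fun t f => ?_) (fun s t f hst => ?_) (fun t => ?_) ?_
  · exact S.sub_mem (S.pow_mem (hYS _ _ (J t).2) _) (hS _)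
  · simp [D, h.pow_apply_one (E t) (J t).2]
  · have := congrArg (fun T => T f) (h.pow_mul_pow (E t) (I t) (I t).2 (J t) (J t).2)
    rw [← map_pow] at this
    simp only [Module.End.mul_apply, LinearMap.add_apply, Algebra.coe_lmul_eq_mul,
      LinearMap.mul_apply_apply, Module.End.one_apply] at this
    simp only [D, ξ, LinearMap.sub_apply, Algebra.coe_lmul_eq_mul, LinearMap.mul_apply_apply, this]
    ring
  · obtain ⟨j', ε', i', rfl⟩ := hmk s
    obtain ⟨j, ε, i, rfl⟩ := hmk t
    rw [hlt] at hst
    refine happ (Commute.sub_left ?_ ((Commute.all _ _).map (Algebra.lmul K R))) f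
    change Commute (Y ε j ^ p ^ (i : ℕ)) (Algebra.lmul K R (x ε' i' ^ p ^ (j' : ℕ)))
    rw [map_pow]
    by_cases hε : ε = ε'
    · subst hε
      rcases hst with hst | ⟨_, hst | ⟨_, hst⟩⟩
      · exact (h.commute_lmul_pow ε i' i'.2 j j.2 j' hst).pow_left _
      · exact absurd hst (lt_irrefl _)
      · exact (h.commute_pow_lmul ε i' i'.2 j j.2 i hst).pow_right _
    · exact (h.commute_lmul ε ε' hε i' i'.2 j j.2).pow_pow _ _
  · obtain ⟨j, ε, i, rfl⟩ := hmk t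
    have hp1 : ξ (mk j ε i) ^ p = x ε i ^ p ^ (j + 1 : ℕ) := by rw [hξ, ← pow_mul, pow_succ]
    rw [hp1]
    by_cases hj : (j : ℕ) + 1 < n
    · refine Algebra.subset_adjoin ⟨mk ⟨j + 1, hj⟩ ε i, ?_, rfl⟩
      rw [Set.mem_ofPred_eq, hlt]
      exact .inl (Nat.lt_succ_self _)
    · rw [show (j : ℕ) + 1 = n by omega, hx ε i i.2]
      exact Subalgebra.algebraMap_mem _ _
  · rw [eq_top_iff, ← htop, Algebra.adjoin_le_iff]
    rintro _ ⟨ε, i, hi, rfl⟩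
    refine Algebra.subset_adjoin ⟨mk ⟨0, by omega⟩ ε ⟨i, hi⟩, ?_⟩
    simp [hξ]

end TripleModel

section Asymb

variable {K : Type*} [Field K] {p : ℕ} [Fact p.Prime] {c : ℕ+ → ℕ+ → MvPolynomial (ℕ+ ⊕ₗ ℕ+) ℤ}
  {n : ℕ} {a b : TruncatedWittVector p n K}

lemma map_cEval_sxm_syn {B : Type*} [Ring B] [Algebra K B]
    (f : FreeAlgebra K (Fin n ⊕ Fin n) →ₐ[K] B) (hc : IsCFamily c)
    {x y : ℕ → B} (hx : ∀ i : Fin n, f (FreeAlgebra.ι K (Sum.inl i)) = x i)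
    (hy : ∀ j : Fin n, f (FreeAlgebra.ι K (Sum.inr j)) = y j) (i j : Fin n) :
    f (cEval (sxm K p n n) (syn K p n n) (c (ppow p i) (ppow p j))) =
      cEval (fun d => x (padicValNat p d)) (fun e => y (padicValNat p e)) (c (ppow p i) (ppow p j)) := by
  refine (map_cEval (f : FreeAlgebra K (Fin n ⊕ Fin n) →+* B) _ _ _).trans ?_
  refine hc.cEval_ppow_congr p (fun r hr => ?_) (fun r hr => ?_)
  · simp only [sxm, padicValNat_ppow, dif_pos (hr.trans i.2)]
    exact hx _
  · simp only [syn, padicValNat_ppow, dif_pos (hr.trans j.2)]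
    exact hy _

lemma Asymb.exists_lift {B : Type*} [Ring B] [Algebra K B] (hc : IsCFamily c) {x y : ℕ → B}
    (hx : ∀ i < n, ∀ j < n, Commute (x i) (x j)) (hy : ∀ i < n, ∀ j < n, Commute (y i) (y j))
    (hxa : ∀ i : Fin n, x i ^ p ^ n = algebraMap K B (a.coeff i))
    (hyb : ∀ j : Fin n, y j ^ p ^ n = algebraMap K B (b.coeff j))
    (hxy : ∀ i < n, ∀ j < n, WittCommRel p c x y i j) :
    ∃ φ : Asymb K p c n n a b →ₐ[K] B, (∀ i, φ (aX K p c n n a b i) = x i) ∧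
      ∀ j, φ (aY K p c n n a b j) = y j := by
  let f : FreeAlgebra K (Fin n ⊕ Fin n) →ₐ[K] B :=
    FreeAlgebra.lift K (Sum.elim (fun i => x i) fun j => y j)
  have hfx (i : Fin n) : f (FreeAlgebra.ι K (Sum.inl i)) = x i := by simp [f]
  have hfy (i : Fin n) : f (FreeAlgebra.ι K (Sum.inr i)) = y i := by simp [f]
  have hf ⦃u v⦄ (h : BmnRel K p c n n u v) : f u = f v := by
    cases h with
    | xx i j => simpa only [map_mul, hfx] using (hx i i.2 j j.2).eq
    | yy i j => simpa only [map_mul, hfy] using (hy i i.2 j j.2).eq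
    | yx i j =>
      rw [map_mul, map_add, map_mul, hfx, hfy]
      exact (hxy i i.2 j j.2).trans (congrArg _ (map_cEval_sxm_syn f hc hfx hfy i j).symm)
  let g : Bmn K p c n n →ₐ[K] B := RingQuot.liftAlgHom K ⟨f, hf⟩
  have hgx (i : Fin n) : g (gx K p c n n i) = x i :=
    (RingQuot.liftAlgHom_mkAlgHom_apply ..).trans (hfx i)
  have hgy (i : Fin n) : g (gy K p c n n i) = y i :=
    (RingQuot.liftAlgHom_mkAlgHom_apply ..).trans (hfy i)
  have hg ⦃u v⦄ (h : ASRel K p c n n a b u v) : g u = g v := by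
    cases h with
    | xa i => rw [map_pow, hgx, hxa, AlgHom.commutes]
    | yb i => rw [map_pow, hgy, hyb, AlgHom.commutes]
  exact ⟨RingQuot.liftAlgHom K ⟨g, hg⟩, fun i => (RingQuot.liftAlgHom_mkAlgHom_apply ..).trans (hgx i),
    fun i => (RingQuot.liftAlgHom_mkAlgHom_apply ..).trans (hgy i)⟩

variable (a b) in
lemma Asymb.adjoin_eq_top : Algebra.adjoin K
    (Set.range (aX K p c n n a b) ∪ Set.range (aY K p c n n a b)) = ⊤ := by
  let π : FreeAlgebra K (Fin n ⊕ Fin n) →ₐ[K] Asymb K p c n n a b :=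
    (RingQuot.mkAlgHom K (ASRel K p c n n a b)).comp (RingQuot.mkAlgHom K (BmnRel K p c n n))
  have hπ : Function.Surjective π :=
    (RingQuot.mkAlgHom_surjective K _).comp (RingQuot.mkAlgHom_surjective K _)
  rw [← (AlgHom.range_eq_top π).2 hπ, ← Algebra.map_top, ← FreeAlgebra.adjoin_range_ι,
    AlgHom.map_adjoin, ← Set.range_comp, ← Set.Sum.elim_range]
  congr 2
  ext (i | j) <;> rfl

variable (a b) in
lemma Asymb.finrank_le (hc : IsCFamily c) : FiniteDimensional K (Asymb K p c n n a b) ∧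
    Module.finrank K (Asymb K p c n n a b) ≤ (p ^ n) ^ n * (p ^ n) ^ n := by
  let π : FreeAlgebra K (Fin n ⊕ Fin n) →ₐ[K] Asymb K p c n n a b :=
    (RingQuot.mkAlgHom K (ASRel K p c n n a b)).comp (RingQuot.mkAlgHom K (BmnRel K p c n n))
  have hπ {u v} (h : BmnRel K p c n n u v) : π u = π v :=
    congrArg (RingQuot.mkAlgHom K (ASRel K p c n n a b)) (RingQuot.mkAlgHom_rel K h)
  let x (i : ℕ) : Asymb K p c n n a b := if h : i < n then aX K p c n n a b ⟨i, h⟩ else 0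
  let y (i : ℕ) : Asymb K p c n n a b := if h : i < n then aY K p c n n a b ⟨i, h⟩ else 0
  have hx (i : Fin n) : x i = aX K p c n n a b i := dif_pos i.2
  have hy (i : Fin n) : y i = aY K p c n n a b i := dif_pos i.2
  have hπx (i : Fin n) : π (FreeAlgebra.ι K (Sum.inl i)) = x i := (hx i).symm
  have hπy (i : Fin n) : π (FreeAlgebra.ι K (Sum.inr i)) = y i := (hy i).symm
  refine hc.finrank_le (p := p) (x := x) (y := y) (a := fun i => if h : i < n then a.coeff ⟨i, h⟩ else 0)
    (b := fun i => if h : i < n then b.coeff ⟨i, h⟩ else 0) (pow_pos (Fact.out : p.Prime).pos n)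
    (fun i hi j hj => ?_) (fun i hi j hj => ?_) (fun i hi => ?_) (fun i hi => ?_)
    (fun i hi j hj => ?_) ?_
  · have := hπ (.xx ⟨i, hi⟩ ⟨j, hj⟩)
    rwa [map_mul, map_mul, hπx, hπx] at this
  · have := hπ (.yy ⟨i, hi⟩ ⟨j, hj⟩)
    rwa [map_mul, map_mul, hπy, hπy] at this
  · have := RingQuot.mkAlgHom_rel K (ASRel.xa (p := p) (c := c) (a := a) (b := b) ⟨i, hi⟩)
    rw [map_pow, AlgHom.commutes] at this
    simp only [x, dif_pos hi]
    exact this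
  · have := RingQuot.mkAlgHom_rel K (ASRel.yb (p := p) (c := c) (a := a) (b := b) ⟨i, hi⟩)
    rw [map_pow, AlgHom.commutes] at this
    simp only [y, dif_pos hi]
    exact this
  · have := hπ (.yx ⟨i, hi⟩ ⟨j, hj⟩)
    rw [map_mul, map_add, map_mul, hπx, hπy] at this
    have key := map_cEval_sxm_syn (p := p) (B := Asymb K p c n n a b) π hc (x := x) (y := y) hπx hπy ⟨i, hi⟩ ⟨j, hj⟩
    exact this.trans (congrArg _ key)
  · rw [← adjoin_eq_top a b]
    have h (z : ℕ → Asymb K p c n n a b) : z '' Set.Iio n = Set.range fun i : Fin n => z i := by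
      ext u
      simp [Fin.exists_iff]
    simp only [h, hx, hy]

end Asymb

section Splitting
open scoped TensorProduct

lemma Matrix.nonempty_fin_one_algEquiv (K A : Type*) [CommSemiring K] [Semiring A] [Algebra K A] :
    Nonempty (Matrix (Fin 1) (Fin 1) A ≃ₐ[K] A) :=
  ⟨{ toFun M := M 0 0
     invFun u := Matrix.of fun _ _ => u
     left_inv M := by
       ext i j
       rw [Subsingleton.elim i 0, Subsingleton.elim j 0]
       rfl
     right_inv _ := rfl
     map_mul' M N := by simp [Matrix.mul_apply]
     map_add' _ _ := rfl
     commutes' _ := rfl }⟩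

lemma brauerEquiv_of_commute {K A₀ A₁ A₂ R : Type*} [Field K] [Ring A₀] [Algebra K A₀] [Ring A₁]
    [Algebra K A₁] [Ring A₂] [Algebra K A₂] [CommRing R] [Nontrivial R] [Algebra K R]
    [FiniteDimensional K R] [FiniteDimensional K A₀] [FiniteDimensional K A₁]
    [FiniteDimensional K A₂] (φ₀ : A₀ →ₐ[K] Module.End K R) (φ₁ : A₁ →ₐ[K] Module.End K R)
    (φ₂ : A₂ →ₐ[K] Module.End K R) (h₀₁ : ∀ u v, Commute (φ₀ u) (φ₁ v))
    (h₀₂ : ∀ u v, Commute (φ₀ u) (φ₂ v)) (h₁₂ : ∀ u v, Commute (φ₁ u) (φ₂ v))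
    (hrank : Module.finrank K A₀ * Module.finrank K A₁ * Module.finrank K A₂ ≤
      Module.finrank K R * Module.finrank K R)
    (htop : φ₀.range ⊔ φ₁.range ⊔ φ₂.range = ⊤) :
    BrauerEquiv K ((A₀ ⊗[K] A₁) ⊗[K] A₂) K := by
  let ψ : A₀ ⊗[K] A₁ →ₐ[K] Module.End K R := Algebra.TensorProduct.lift φ₀ φ₁ h₀₁
  have hψ (u v) : ψ (u ⊗ₜ v) = φ₀ u * φ₁ v := Algebra.TensorProduct.lift_tmul _ _ _ _ _
  have hψ₂ (t w) : Commute (ψ t) (φ₂ w) := by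
    induction t with
    | zero => simp
    | add t t' ht ht' => rw [map_add]; exact ht.add_left ht'
    | tmul u v => rw [hψ]; exact (h₀₂ u w).mul_left (h₁₂ v w)
  let Φ : (A₀ ⊗[K] A₁) ⊗[K] A₂ →ₐ[K] Module.End K R := Algebra.TensorProduct.lift ψ φ₂ hψ₂
  have hΦ (t w) : Φ (t ⊗ₜ w) = ψ t * φ₂ w := Algebra.TensorProduct.lift_tmul _ _ _ _ _
  have hsurj : Function.Surjective Φ := by
    rw [← AlgHom.range_eq_top, eq_top_iff, ← htop]
    refine sup_le (sup_le ?_ ?_) ?_ <;> rintro _ ⟨u, rfl⟩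
    · exact ⟨(u ⊗ₜ 1) ⊗ₜ 1, by simp [hΦ, hψ]⟩
    · exact ⟨(1 ⊗ₜ u) ⊗ₜ 1, by simp [hΦ, hψ]⟩
    · exact ⟨1 ⊗ₜ u, by simp [hΦ]⟩
  have hfin : Module.finrank K ((A₀ ⊗[K] A₁) ⊗[K] A₂) = Module.finrank K (Module.End K R) := by
    refine le_antisymm ?_ (LinearMap.finrank_le_finrank_of_surjective (f := Φ.toLinearMap) hsurj)
    rwa [Module.finrank_tensorProduct, Module.finrank_tensorProduct, Module.finrank_linearMap]
  have hinj : Function.Injective Φ :=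
    (LinearMap.injective_iff_surjective_of_finrank_eq_finrank (f := Φ.toLinearMap) hfin).2 hsurj
  refine ⟨1, Module.finrank K R, one_pos, Module.finrank_pos, ⟨?_⟩⟩
  exact ((Matrix.nonempty_fin_one_algEquiv K _).some.trans
    (AlgEquiv.ofBijective Φ ⟨hinj, hsurj⟩)).trans (algEquivMatrix (Module.finBasis K R))

end Splitting

open scoped TensorProduct

set_option maxSynthPendingDepth 3 in
set_option synthInstance.maxHeartbeats 1000000 in
set_option maxHeartbeats 1000000 in
/-- Let `p` be a prime, `K` a field of characteristic `p` and `n ∈ ℕ`.  Then for all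
`a, b, c ∈ W_n(K)` one has `((a, bc))_{p^n} + ((b, ac))_{p^n} + ((c, ab))_{p^n} = 0`
in `Br(K)` — i.e. the tensor product
`A_{((a,bc))_{p^n}} ⊗ A_{((b,ac))_{p^n}} ⊗ A_{((c,ab))_{p^n}}` is split — where
`bc, ac, ab` are products in the ring `W_n(K)` of truncated `p`-typical Witt vectors. -/
theorem symbol_triple_relation (p : ℕ) [Fact p.Prime] (K : Type*) [Field K] [CharP K p]
    (n : ℕ) (cP : ℕ+ → ℕ+ → MvPolynomial (ℕ+ ⊕ₗ ℕ+) ℤ) (hc : IsCFamily cP)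
    (a b c : TruncatedWittVector p n K) :
    BrauerEquiv K
      ((Asymb K p cP n n a (b * c) ⊗[K] Asymb K p cP n n b (a * c)) ⊗[K]
        Asymb K p cP n n c (a * b)) K := by
  let w : Fin 3 → TruncatedWittVector p n K := ![a, b, c]
  choose A hA using fun ε => WittVector.truncate_surjective p n K (w ε)
  obtain ⟨R, _, _, x, Y, _, h, hx, hY, htop⟩ := hc.exists_tripleOperators n A
  let E (ε : Fin 3) := Asymb K p cP n n (w ε) (w (ε + 1) * w (ε + 2))
  have hφ (ε : Fin 3) : ∃ φ : E ε →ₐ[K] Module.End K R,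
      (∀ i, φ (aX K p cP n n _ _ i) = Algebra.lmul K R (x ε i)) ∧ ∀ j, φ (aY K p cP n n _ _ j) = Y ε j := by
    refine Asymb.exists_lift hc (x := fun i => Algebra.lmul K R (x ε i)) (y := Y ε)
      (fun i _ j _ => (Commute.all _ _).map (Algebra.lmul K R))
      (fun i hi j hj => h.commute ε ε i hi j hj) (fun i => ?_) (fun j => ?_) (h.rel ε)
    · rw [← map_pow, hx ε i i.2, AlgHom.commutes, ← hA, WittVector.coeff_truncate]
    · rw [hY ε j j.2, ← hA, ← hA, ← map_mul, WittVector.coeff_truncate]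
  choose φ hφx hφy using hφ
  let G (ε : Fin 3) : Set (Module.End K R) :=
    Set.range (fun i : Fin n => Algebra.lmul K R (x ε i)) ∪ Set.range fun j : Fin n => Y ε j
  have hG (ε) : (φ ε).range = Algebra.adjoin K (G ε) := by
    rw [← Algebra.map_top, ← Asymb.adjoin_eq_top, AlgHom.map_adjoin, Set.image_union, ← Set.range_comp,
      ← Set.range_comp]
    congr 3 <;> ext i : 1
    exacts [hφx ε i, hφy ε i]
  have hcomm {ε δ : Fin 3} (hεδ : ε ≠ δ) (u v) : Commute (φ ε u) (φ δ v) := by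
    have hu : φ ε u ∈ Algebra.adjoin K (G ε) := hG ε ▸ ⟨u, rfl⟩
    have hv : φ δ v ∈ Algebra.adjoin K (G δ) := hG δ ▸ ⟨v, rfl⟩
    refine Algebra.commute_of_mem_adjoin_of_forall_mem_commute hv fun g hg => Commute.symm ?_
    refine Algebra.commute_of_mem_adjoin_of_forall_mem_commute hu fun f hf => ?_
    rcases hf with ⟨i, rfl⟩ | ⟨i, rfl⟩ <;> rcases hg with ⟨j, rfl⟩ | ⟨j, rfl⟩
    · exact (Commute.all _ _).map (Algebra.lmul K R)
    · exact h.commute_lmul δ ε hεδ.symm i i.2 j j.2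
    · exact (h.commute_lmul ε δ hεδ j j.2 i i.2).symm
    · exact h.commute δ ε j j.2 i i.2
  have hS (ε) : (φ ε).range ≤ (φ 0).range ⊔ (φ 1).range ⊔ (φ 2).range := by
    fin_cases ε
    exacts [le_sup_left.trans le_sup_left, le_sup_right.trans le_sup_left, le_sup_right]
  obtain ⟨_, hrank, htop'⟩ := h.finrank_and_eq_top hx htop
    (fun ε i hi => hS ε ⟨_, hφx ε ⟨i, hi⟩⟩) fun ε j hj => hS ε ⟨_, hφy ε ⟨j, hj⟩⟩
  have hE (ε) := Asymb.finrank_le (w ε) (w (ε + 1) * w (ε + 2)) hc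
  have := fun ε => (hE ε).1
  have key := brauerEquiv_of_commute (φ 0) (φ 1) (φ 2) (hcomm (by decide)) (hcomm (by decide))
    (hcomm (by decide)) (by
      rw [hrank]
      refine (Nat.mul_le_mul (Nat.mul_le_mul (hE 0).2 (hE 1).2) (hE 2).2).trans_eq ?_
      rw [← pow_mul, ← pow_add, ← pow_add, ← pow_add, ← pow_add]
      congr 1
      ring) htop'
  rw [mul_comm a c]
  exact key

end
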